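/- arXiv:2409.00692 — 7 statements merged into one kernel-verified Lean document; each statement's English description precedes it below -/
import Mathlib

section
/- Let A_0, ..., A_{d+1} (d ≥ 1) be a commutative association scheme on a finite nonempty set X with A_dᵀ = A_{d+1} and A_iᵀ = A_i for 0 ≤ i ≤ d-1, let M be its Bose-Mesner algebra, and let M̃ be the Bose-Mesner algebra of its symmetrization. If the matrix A_d + A_{d+1} generates M̃, then (1) A_d has exactly d+2 distinct eigenvalues, and (2) A_d generates M. -/
open Matrix Polynomial

def IsZeroOne {X : Type*} (A : Matrix X X ℂ) : Prop :=
  ∀ i j, A i j = 0 ∨ A i j = 1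

def IsAssocScheme {X : Type*} [Fintype X] [DecidableEq X] {d : ℕ}
    (A : Fin (d+1) → Matrix X X ℂ) : Prop :=
  (∀ i, A i ≠ 0) ∧
  (∀ i, IsZeroOne (A i)) ∧
  A 0 = 1 ∧
  (∑ i, A i) = Matrix.of (fun _ _ => (1:ℂ)) ∧
  (∀ i, ∃ i', (A i)ᵀ = A i') ∧
  (∀ i j, A i * A j = A j * A i) ∧
  (∀ i j, ∃ p : Fin (d+1) → ℕ, A i * A j = ∑ l, (p l : ℂ) • A l)

def Generates {X : Type*} [Fintype X] [DecidableEq X] {d : ℕ}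
    (A : Fin (d+1) → Matrix X X ℂ) (B : Matrix X X ℂ) : Prop :=
  ∀ C ∈ Submodule.span ℂ (Set.range A), ∃ q : Polynomial ℂ, C = Polynomial.aeval B q

noncomputable def numDistinctEigen {X : Type*} [Fintype X] [DecidableEq X]
    (B : Matrix X X ℂ) : ℕ :=
  B.charpoly.roots.toFinset.card

def ArePrimIdem {X : Type*} [Fintype X] [DecidableEq X] {d : ℕ}
    (A E : Fin (d+1) → Matrix X X ℂ) : Prop :=
  (∀ i, E i ∈ Submodule.span ℂ (Set.range A)) ∧
  E 0 = ((Fintype.card X : ℂ))⁻¹ • Matrix.of (fun _ _ => (1:ℂ)) ∧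
  (∀ i j, E i * E j = if i = j then E i else 0) ∧
  (∑ i, E i) = 1 ∧
  (∀ i j, ∃ p : ℂ, A i * E j = p • E j)

def IsAmorphic {X : Type*} [Fintype X] [DecidableEq X] {d : ℕ}
    (A : Fin (d+1) → Matrix X X ℂ) : Prop :=
  ∀ (e : ℕ) (Λ : Fin (e+1) → Finset (Fin (d+1))),
    Λ 0 = {0} →
    (∀ i, (Λ i).Nonempty) →
    (∀ i j, i ≠ j → Disjoint (Λ i) (Λ j)) →
    (∀ m, ∃ i, m ∈ Λ i) →
    ∀ i j, ∃ p : Fin (e+1) → ℕ,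
      (∑ α ∈ Λ i, A α) * (∑ β ∈ Λ j, A β) = ∑ l, (p l : ℂ) • (∑ α ∈ Λ l, A α)

def HasForm12 {X : Type*} [Fintype X] [DecidableEq X] {d : ℕ}
    (A E : Fin (d+1) → Matrix X X ℂ) (k a b : Fin (d+1) → ℂ) : Prop :=
  ∀ i : Fin (d+1), i ≠ 0 →
    A i * E 0 = k i • E 0 ∧
    A i * E i = b i • E i ∧
    (∀ j : Fin (d+1), j ≠ 0 → j ≠ i → A i * E j = a i • E j) ∧
    a i ≠ b i

def symmetrization {X : Type*} {d : ℕ} (A : Fin (d+2) → Matrix X X ℂ) :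
    Fin (d+1) → Matrix X X ℂ :=
  fun i => if i = Fin.last d then A i.castSucc + A (Fin.last (d+1)) else A i.castSucc

def IsSRGGraph {V : Type*} (H : SimpleGraph V) (n k l m : ℕ) : Prop :=
  Nat.card V = n ∧
  (∀ v, (H.neighborSet v).ncard = k) ∧
  (∃ v w, H.Adj v w) ∧
  (∃ v w, v ≠ w ∧ ¬ H.Adj v w) ∧
  (∀ v w, H.Adj v w → ((H.neighborSet v) ∩ (H.neighborSet w)).ncard = l) ∧
  (∀ v w, v ≠ w → ¬ H.Adj v w → ((H.neighborSet v) ∩ (H.neighborSet w)).ncard = m)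

open Classical in
noncomputable def graphEigSet {V : Type*} [Fintype V] (H : SimpleGraph V) : Set ℂ :=
  ((Matrix.of (fun x y : V => if H.Adj x y then (1:ℂ) else 0)).charpoly.roots.toFinset : Set ℂ)

open Classical in
def IsDisjointUnionSRGs {V : Type*} [Fintype V] (G : SimpleGraph V)
    (N w k : ℕ) (r s : ℂ) : Prop :=
  Nat.card G.ConnectedComponent = N ∧
  r ≠ (k : ℂ) ∧ s ≠ (k : ℂ) ∧
  ∀ c : G.ConnectedComponent,
    c.supp.ncard = w ∧
    (G.induce c.supp).Connected ∧
    (∃ l m : ℕ, IsSRGGraph (G.induce c.supp) w k l m) ∧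
    graphEigSet (G.induce c.supp) = {(k : ℂ), r, s}

open scoped Matrix.Norms.L2Operator in
lemma aux_cfc {X : Type*} [Fintype X] [DecidableEq X] (N : Matrix X X ℂ) (hN : IsStarNormal N) :
    (∃ q : Polynomial ℂ, star N = aeval N q) ∧
    (∀ p : Polynomial ℂ, (∀ z ∈ spectrum ℂ N, p.eval z = 0) → aeval N p = 0) := by
  have hfin : (spectrum ℂ N).Finite := Matrix.finite_spectrum N
  constructor
  · refine ⟨Lagrange.interpolate hfin.toFinset id (fun z => star z), ?_⟩
    rw [← cfc_polynomial _ N hN, ← cfc_star_id (R := ℂ) (a := N) (p := IsStarNormal)]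
    apply cfc_congr
    intro z hz
    exact (Lagrange.eval_interpolate_at_node (s := hfin.toFinset) (v := id) (i := z)
      (fun z => star z) Function.injective_id.injOn (hfin.mem_toFinset.2 hz)).symm
  · intro p hp
    rw [← cfc_polynomial p N hN, ← cfc_zero ℂ N]
    exact cfc_congr fun z hz => hp z hz

lemma aux_gen {X : Type*} [Fintype X] [DecidableEq X] (N : Matrix X X ℂ) (hN : IsStarNormal N)
    (M : Submodule ℂ (Matrix X X ℂ)) (h1 : ∀ p : Polynomial ℂ, aeval N p ∈ M)
    (h2 : ∀ C ∈ M, ∃ q : Polynomial ℂ, C = aeval N q) :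
    numDistinctEigen N = Module.finrank ℂ M := by
  have hS : ∀ z, z ∈ spectrum ℂ N ↔ z ∈ N.charpoly.roots.toFinset := by
    intro z
    rw [Matrix.mem_spectrum_iff_isRoot_charpoly, Multiset.mem_toFinset,
      mem_roots (Matrix.charpoly_monic N).ne_zero]
  set S := N.charpoly.roots.toFinset with hSdef
  let L : Polynomial ℂ →ₗ[ℂ] (S → ℂ) := LinearMap.pi (fun z => Polynomial.leval z.1)
  let T : Polynomial ℂ →ₗ[ℂ] Matrix X X ℂ := (aeval N).toLinearMap
  have hL : LinearMap.range L = ⊤ := by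
    rw [LinearMap.range_eq_top]
    intro f
    classical
    refine ⟨Lagrange.interpolate S id (fun z => if h : z ∈ S then f ⟨z, h⟩ else 0), ?_⟩
    ext z
    have := Lagrange.eval_interpolate_at_node (s := S) (v := id) (i := z.1)
      (fun z => if h : z ∈ S then f ⟨z, h⟩ else 0) (Function.injective_id.injOn) z.2
    simp only [z.2, dite_true, id] at this
    exact this
  have hR : LinearMap.range T = M := by
    ext C
    constructor
    · rintro ⟨p, rfl⟩; exact h1 p
    · intro h; obtain ⟨q, hq⟩ := h2 C h; exact ⟨q, hq.symm⟩
  have hK : LinearMap.ker L = LinearMap.ker T := by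
    ext p
    rw [LinearMap.mem_ker, LinearMap.mem_ker]
    constructor
    · intro h
      apply (aux_cfc N hN).2
      intro z hz
      exact congrFun h ⟨z, (hS z).1 hz⟩
    · intro h
      ext z
      have hz := (hS z).2 z.2
      have h3 : p.eval z.1 ∈ spectrum ℂ (aeval N p) :=
        spectrum.subset_polynomial_aeval N p ⟨z.1, hz, rfl⟩
      have h0 : aeval N p = 0 := h
      rw [h0] at h3
      by_contra hne
      apply h3
      have hne' : p.eval z.1 ≠ 0 := hne
      rw [spectrum.mem_resolventSet_iff, sub_zero]
      exact (IsUnit.mk0 _ hne').map _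
  have e1 := L.quotKerEquivRange
  have e2 := T.quotKerEquivRange
  have e3 := Submodule.quotEquivOfEq _ _ hK
  have := (e1.symm.trans (e3.trans e2)).finrank_eq
  rw [hL, hR, finrank_top] at this
  rw [← this]
  simp [numDistinctEigen, ← hSdef]

lemma aux_indep {X : Type*} [Fintype X] [DecidableEq X] {d : ℕ}
    (A : Fin (d+1) → Matrix X X ℂ) (hA : IsAssocScheme A) : LinearIndependent ℂ A := by
  obtain ⟨hne, h01, h0, hsum, -, -, -⟩ := hA
  rw [Fintype.linearIndependent_iff]
  intro g hg i
  obtain ⟨x, y, hxy⟩ : ∃ x y, A i x y ≠ 0 := by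
    by_contra! h
    exact hne i (by ext x y; exact h x y)
  have hi : A i x y = 1 := (h01 i x y).resolve_left hxy
  have hs : ∑ j, A j x y = 1 := by
    have := congrFun (congrFun hsum x) y
    simpa [Matrix.sum_apply] using this
  choose b hb using fun j => (show ∃ n : ℕ, A j x y = n by
    rcases h01 j x y with h | h
    · exact ⟨0, by simp [h]⟩
    · exact ⟨1, by simp [h]⟩)
  have hz : ∀ j, j ≠ i → A j x y = 0 := by
    rw [← Finset.add_sum_erase _ _ (Finset.mem_univ i), hi] at hs
    simp only [hb] at hs
    have h2 : ∑ j ∈ Finset.univ.erase i, b j = 0 := by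
      have : (1 : ℂ) + ((∑ j ∈ Finset.univ.erase i, b j : ℕ) : ℂ) = 1 := by
        push_cast; exact hs
      exact_mod_cast add_eq_left.1 this
    intro j hj
    rw [Finset.sum_eq_zero_iff] at h2
    rw [hb, h2 j (by simp [hj])]; simp
  have hg' := congrFun (congrFun hg x) y
  simp only [Matrix.sum_apply, Matrix.smul_apply, Matrix.zero_apply, smul_eq_mul] at hg'
  rw [Finset.sum_eq_single i (fun j _ hj => by rw [hz j hj, mul_zero]) (by simp), hi] at hg'
  simpa using hg'

theorem stmt0 {X : Type*} [Fintype X] [DecidableEq X] [Nonempty X]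
    {d : ℕ} (hd : 1 ≤ d) (A : Fin (d+2) → Matrix X X ℂ)
    (hA : IsAssocScheme A)
    (hT : (A ⟨d, by omega⟩)ᵀ = A ⟨d+1, by omega⟩)
    (hS : ∀ i : Fin (d+2), (i : ℕ) < d → (A i)ᵀ = A i)
    (hGen : Generates (symmetrization A) (A ⟨d, by omega⟩ + A ⟨d+1, by omega⟩)) :
    numDistinctEigen (A ⟨d, by omega⟩) = d + 2 ∧
    Generates A (A ⟨d, by omega⟩) := by
  have hind := aux_indep A hA
  obtain ⟨hne, h01, h0, hsum, -, hcomm, hmul⟩ := hA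
  set N := A ⟨d, by omega⟩ with hNdef
  have hstar : star N = A ⟨d+1, by omega⟩ := by
    rw [← hT]
    ext x y
    rw [Matrix.star_apply, Matrix.transpose_apply]
    rcases h01 ⟨d, by omega⟩ y x with h | h <;> rw [← hNdef] at h <;> simp [h]
  have hN : IsStarNormal N := ⟨by
    rw [hstar]; exact hcomm _ _⟩
  obtain ⟨⟨q, hq⟩, -⟩ := aux_cfc N hN
  rw [hstar] at hq
  have hAi : ∀ i, A i ∈ LinearMap.range (aeval (R := ℂ) N).toLinearMap := by
    intro i
    by_cases hi : (i : ℕ) < d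
    · obtain ⟨p, hp⟩ := hGen (A i) (Submodule.subset_span ⟨⟨i, by omega⟩, by
        have : (⟨i, by omega⟩ : Fin (d+1)) ≠ Fin.last d := by
          intro h; have := congrArg Fin.val h; simp at this; omega
        simp only [symmetrization, if_neg this]; rfl⟩)
      refine ⟨p.comp (Polynomial.X + q), ?_⟩
      simp only [AlgHom.toLinearMap_apply]
      rw [aeval_comp, hp, hq]; simp
    · by_cases h : (i : ℕ) = d
      · refine ⟨Polynomial.X, ?_⟩
        have : i = ⟨d, by omega⟩ := Fin.ext h
        simp [this, hNdef]
      · refine ⟨q, ?_⟩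
        have : i = ⟨d+1, by omega⟩ := Fin.ext (by simp; omega)
        rw [this, hq]; rfl
  have hgenA : Generates A N := by
    intro C hC
    have : Submodule.span ℂ (Set.range A) ≤ LinearMap.range (aeval (R := ℂ) N).toLinearMap := by
      rw [Submodule.span_le]
      rintro _ ⟨i, rfl⟩
      exact hAi i
    obtain ⟨p, hp⟩ := this hC
    exact ⟨p, hp.symm⟩
  refine ⟨?_, hgenA⟩
  have hM : ∀ p : Polynomial ℂ, aeval N p ∈ Submodule.span ℂ (Set.range A) := by
    have hmulN : ∀ C ∈ Submodule.span ℂ (Set.range A),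
        C * N ∈ Submodule.span ℂ (Set.range A) := by
      intro C hC
      induction hC using Submodule.span_induction with
      | mem x h =>
        obtain ⟨i, rfl⟩ := h
        obtain ⟨p, hp⟩ := hmul i ⟨d, by omega⟩
        rw [hNdef, hp]
        exact Submodule.sum_mem _ fun l _ => Submodule.smul_mem _ _ (Submodule.subset_span ⟨l, rfl⟩)
      | zero => simp
      | add x y _ _ hx hy => rw [add_mul]; exact Submodule.add_mem _ hx hy
      | smul a x _ hx => rw [smul_mul_assoc]; exact Submodule.smul_mem _ _ hx
    have hpow : ∀ n : ℕ, N ^ n ∈ Submodule.span ℂ (Set.range A) := by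
      intro n
      induction n with
      | zero => rw [pow_zero, ← h0]; exact Submodule.subset_span ⟨0, rfl⟩
      | succ n ih => rw [pow_succ]; exact hmulN _ ih
    intro p
    rw [aeval_eq_sum_range]
    exact Submodule.sum_mem _ fun l _ => Submodule.smul_mem _ _ (hpow l)
  rw [aux_gen N hN _ hM hgenA, finrank_span_eq_card hind]
  simp
end

section
/- Let Ã_0, Ã_1, ..., Ã_d (d ≥ 3) be a symmetric amorphic association scheme on a finite nonempty set X whose primitive idempotents are ordered Ẽ_0, Ẽ_1, ..., Ẽ_d so that the character table has the form (1.2), with entries k_i, a_i, b_i. Then a_i + b_j = a_j + b_i for all 1 ≤ i < j ≤ d. -/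
open Matrix Polynomial

lemma scheme_disjoint {X : Type*} [Fintype X] [DecidableEq X] {d : ℕ}
    {A : Fin (d+1) → Matrix X X ℂ} (hA : IsAssocScheme A) {i j : Fin (d+1)} (hij : i ≠ j)
    {x y : X} (h : A i x y ≠ 0) : A j x y = 0 := by
  obtain ⟨-, h01, -, hsum, -⟩ := hA
  by_contra hj
  have hi1 := (h01 i x y).resolve_left h
  have hj1 := (h01 j x y).resolve_left hj
  have hs := congrArg Complex.re (congrFun (congrFun hsum x) y)
  rw [Matrix.sum_apply, Complex.re_sum] at hs
  have hle : ∑ l ∈ {i, j}, (A l x y).re ≤ ∑ l, (A l x y).re := by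
    apply Finset.sum_le_sum_of_subset_of_nonneg (Finset.subset_univ _)
    intro l _ _
    rcases h01 l x y with h | h <;> simp [h]
  rw [hs, Finset.sum_pair hij, hi1, hj1] at hle
  norm_num at hle

lemma scheme_entry {X : Type*} [Fintype X] [DecidableEq X] {d : ℕ}
    {A : Fin (d+1) → Matrix X X ℂ} (hA : IsAssocScheme A) (i : Fin (d+1)) :
    ∃ x y, A i x y ≠ 0 := by
  by_contra h
  push Not at h
  exact hA.1 i (by ext x y; simpa using h x y)

lemma idem_ne_zero {X : Type*} [Fintype X] [DecidableEq X]
    {d : ℕ} (hd : 3 ≤ d) (A E : Fin (d+1) → Matrix X X ℂ)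
    (k a b : Fin (d+1) → ℂ)
    (hA : IsAssocScheme A)
    (hE : ArePrimIdem A E)
    (hP : HasForm12 A E k a b) (j : Fin (d+1)) (hj : j ≠ 0) : E j ≠ 0 := by
  intro hz
  obtain ⟨-, hE0, -, hEs, -⟩ := hE
  obtain ⟨p0, -, pj, -⟩ := hP j hj
  have key : A j = a j • (1 - E 0) + k j • E 0 := by
    have h1 : A j = ∑ m, A j * E m := by rw [← Finset.mul_sum, hEs, mul_one]
    have h2 : ∀ m, A j * E m = a j • E m + (if m = 0 then (k j - a j) • E 0 else 0) := by
      intro m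
      by_cases hm : m = 0
      · subst hm; rw [p0, if_pos rfl, ← add_smul]; congr 1; ring
      · by_cases hmj : m = j
        · subst hmj; simp [hz, hm]
        · rw [pj m hm hmj, if_neg hm, add_zero]
    rw [h1, Finset.sum_congr rfl (fun m _ => h2 m), Finset.sum_add_distrib, ← Finset.smul_sum, hEs]
    simp only [Finset.sum_ite_eq', Finset.mem_univ, if_true]
    module
  obtain ⟨i, hi0, hij⟩ : ∃ i : Fin (d+1), i ≠ 0 ∧ i ≠ j := by
    by_cases h : j.val = 1
    · exact ⟨⟨2, by omega⟩, by simp [Fin.ext_iff], by simp [Fin.ext_iff, h]⟩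
    · exact ⟨⟨1, by omega⟩, by simp [Fin.ext_iff], by simp [Fin.ext_iff]; omega⟩
  have ent : ∀ x y, (1 : Matrix X X ℂ) x y = 0 →
      A j x y = (k j - a j) * (Fintype.card X : ℂ)⁻¹ := by
    intro x y h
    rw [key, hE0]
    simp [h]
    ring
  obtain ⟨x, y, hxy⟩ := scheme_entry hA j
  obtain ⟨u, v, huv⟩ := scheme_entry hA i
  have e1 := ent x y (by rw [← hA.2.2.1]; exact scheme_disjoint hA hj hxy)
  have e2 := ent u v (by rw [← hA.2.2.1]; exact scheme_disjoint hA hi0 huv)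
  rw [scheme_disjoint hA hij huv] at e2
  exact hxy (e1.trans e2.symm)

lemma row_sum {X : Type*} [Fintype X] [DecidableEq X] [Nonempty X]
    {d : ℕ} (hd : 3 ≤ d) (A E : Fin (d+1) → Matrix X X ℂ)
    (k a b : Fin (d+1) → ℂ)
    (hA : IsAssocScheme A)
    (hE : ArePrimIdem A E)
    (hP : HasForm12 A E k a b) (j : Fin (d+1)) (hj : j ≠ 0) :
    (∑ i, if i = 0 then 1 else a i) + (b j - a j) = 0 := by
  have hne := idem_ne_zero hd A E k a b hA hE hP j hj
  obtain ⟨-, hE0, hEE, hEs, -⟩ := hE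
  have hJ : (∑ i, A i) * E j = 0 := by
    have h0 : (∑ i, A i) = (Fintype.card X : ℂ) • E 0 := by
      rw [hA.2.2.2.1, hE0, smul_smul, mul_inv_cancel₀ (by simp), one_smul]
    rw [h0, smul_mul_assoc, hEE, if_neg (Ne.symm hj), smul_zero]
  have h2 : ∀ i, A i * E j =
      ((if i = 0 then 1 else a i) + (if i = j then b j - a j else 0)) • E j := by
    intro i
    by_cases hi : i = 0
    · subst hi; simp [hA.2.2.1, Ne.symm hj]
    · by_cases hij : i = j
      · subst hij; rw [(hP i hi).2.1]; simp [hi]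
      · rw [(hP i hi).2.2.1 j hj (Ne.symm hij)]; simp [hi, hij]
  rw [Finset.sum_mul, Finset.sum_congr rfl (fun m _ => h2 m), ← Finset.sum_smul,
    Finset.sum_add_distrib] at hJ
  simpa using (smul_eq_zero.mp hJ).resolve_right hne

theorem stmt5 {X : Type*} [Fintype X] [DecidableEq X] [Nonempty X]
    {d : ℕ} (hd : 3 ≤ d) (A E : Fin (d+1) → Matrix X X ℂ)
    (k a b : Fin (d+1) → ℂ)
    (hA : IsAssocScheme A)
    (hS : ∀ i, (A i)ᵀ = A i)
    (hE : ArePrimIdem A E)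
    (hAm : IsAmorphic A)
    (hP : HasForm12 A E k a b) :
    ∀ i j : Fin (d+1), i ≠ 0 → (i : ℕ) < (j : ℕ) → a i + b j = a j + b i := by
  intro i j hi hij
  have hj : j ≠ 0 := by
    rintro rfl
    simp at hij
  have h1 := row_sum hd A E k a b hA hE hP i hi
  have h2 := row_sum hd A E k a b hA hE hP j hj
  linear_combination h2 - h1
end

section
/- Let A_0, ..., A_{d+1} (d ≥ 2) be a commutative association scheme on a finite nonempty set X with A_dᵀ = A_{d+1} and A_iᵀ = A_i for 0 ≤ i ≤ d-1, whose symmetrization is amorphic with character table of the form (1.2). Let Λ be a nonempty subset of {1, 2, ..., d+1}. If the matrix Σ_{h∈Λ} A_h has exactly d+2 distinct eigenvalues, then exactly one of the two indices d and d+1 belongs to Λ. -/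
open Matrix Polynomial

theorem eig_card_le {X : Type*} [Fintype X] [DecidableEq X] {n : ℕ}
    (B : Matrix X X ℂ) (E : Fin n → Matrix X X ℂ) (c : Fin n → ℂ)
    (horth : ∀ i j, E i * E j = if i = j then E i else 0)
    (hsum : (∑ i, E i) = 1) (hB : ∀ j, B * E j = c j • E j) :
    numDistinctEigen B ≤ n := by
  have hcomm : ∀ j, E j * B = c j • E j := by
    intro j
    calc E j * B = E j * (B * ∑ i, E i) := by rw [hsum, mul_one]
      _ = ∑ i, c i • (E j * E i) := by simp [Finset.mul_sum, hB]
      _ = c j • E j := by simp [horth]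
  have hsub : B.charpoly.roots.toFinset ⊆ Finset.univ.image c := by
    intro μ hμ
    rw [Multiset.mem_toFinset, mem_roots (Matrix.charpoly_monic B).ne_zero, IsRoot.def,
      Matrix.eval_charpoly] at hμ
    obtain ⟨v, hv, hv'⟩ := Matrix.exists_mulVec_eq_zero_iff.mpr hμ
    have hBv : B *ᵥ v = μ • v := by
      rw [Matrix.sub_mulVec, sub_eq_zero] at hv'
      rw [← hv']
      ext x
      simp
    have : ∃ j, E j *ᵥ v ≠ 0 := by
      by_contra! h
      apply hv
      rw [← Matrix.one_mulVec v, ← hsum, Matrix.sum_mulVec]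
      simp [h]
    obtain ⟨j, hj⟩ := this
    have h1 : c j • (E j *ᵥ v) = μ • (E j *ᵥ v) := by
      rw [← Matrix.smul_mulVec, ← hcomm, ← Matrix.mulVec_mulVec, hBv, Matrix.mulVec_smul]
    exact Finset.mem_image.mpr ⟨j, Finset.mem_univ _, smul_left_injective ℂ hj h1⟩
  calc _ ≤ (Finset.univ.image c).card := Finset.card_le_card hsub
    _ ≤ n := by simpa using Finset.card_image_le (s := Finset.univ) (f := c)

theorem stmt6 {X : Type*} [Fintype X] [DecidableEq X] [Nonempty X]
    {d : ℕ} (hd : 2 ≤ d) (A : Fin (d+2) → Matrix X X ℂ)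
    (Et : Fin (d+1) → Matrix X X ℂ) (k a b : Fin (d+1) → ℂ)
    (hA : IsAssocScheme A)
    (hT : (A ⟨d, by omega⟩)ᵀ = A ⟨d+1, by omega⟩)
    (hS : ∀ i : Fin (d+2), (i : ℕ) < d → (A i)ᵀ = A i)
    (hEt : ArePrimIdem (symmetrization A) Et)
    (hAm : IsAmorphic (symmetrization A))
    (hP : HasForm12 (symmetrization A) Et k a b)
    (Λ : Finset (Fin (d+2))) (hne : Λ.Nonempty) (h0 : (0 : Fin (d+2)) ∉ Λ)
    (hEig : numDistinctEigen (∑ h ∈ Λ, A h) = d + 2) :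
    Xor' ((⟨d, by omega⟩ : Fin (d+2)) ∈ Λ) ((⟨d+1, by omega⟩ : Fin (d+2)) ∈ Λ) := by
  by_contra hx
  have hiff : Fin.castSucc (Fin.last d) ∈ Λ ↔ Fin.last (d+1) ∈ Λ := by
    have h := (not_xor _ _).mp hx
    exact h
  obtain ⟨-, -, horth, hsum, hp⟩ := hEt
  choose p hp using hp
  have key : ∑ h ∈ Λ, A h
      = ∑ i, if i.castSucc ∈ Λ then symmetrization A i else 0 := by
    have e : ∑ h ∈ Λ, A h = ∑ h, if h ∈ Λ then A h else 0 := by simp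
    rw [e]
    rw [Fin.sum_univ_castSucc, Fin.sum_univ_castSucc, Fin.sum_univ_castSucc]
    have hl : ∀ i : Fin d, symmetrization A i.castSucc = A i.castSucc.castSucc := by
      intro i
      simp [symmetrization, (Fin.castSucc_lt_last i).ne]
    simp only [hl]
    rw [add_assoc]
    congr 1
    by_cases h : Fin.last (d+1) ∈ Λ
    · simp [hiff.mpr h, h, symmetrization]
    · simp [mt hiff.mp h, h]
  have hle := eig_card_le (∑ h ∈ Λ, A h) Et
    (fun j => ∑ i, if i.castSucc ∈ Λ then p i j else 0) horth hsum (by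
      intro j
      rw [key, Finset.sum_mul, Finset.sum_smul]
      refine Finset.sum_congr rfl fun i _ => ?_
      split_ifs <;> simp [hp])
  omega
end

section
/- Let A_0, ..., A_{d+1} be a commutative association scheme on a finite nonempty set X with A_dᵀ = A_{d+1} and A_iᵀ = A_i for 0 ≤ i ≤ d-1, with primitive idempotents E_0, ..., E_{d+1}, whose symmetrization is amorphic with primitive idempotents ordered Ẽ_0, Ẽ_1, ..., Ẽ_d so that the character table has the form (1.2) with entries k_i, a_i, b_i. Suppose 1 ≤ i, j ≤ d+1 with i ≠ j are such that each of E_i and E_j equals Ẽ_p for some 1 ≤ p ≤ d-1, and suppose 1 ≤ r, s ≤ d-1 satisfy A_r E_i = a_r E_i, A_r E_j = b_r E_j, A_s E_i = b_s E_i and A_s E_j = a_s E_j. Then for every index t ∈ {0, 1, ..., d+1} with t ∉ {r, s}, there exists a scalar c with A_t E_i = c E_i and A_t E_j = c E_j. -/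
open Matrix Polynomial

theorem symm_transpose_aux {X : Type*} {d : ℕ} (A : Fin (d+2) → Matrix X X ℂ)
    (hT : (A (Fin.last d).castSucc)ᵀ = A (Fin.last (d+1)))
    (hS : ∀ i : Fin (d+2), (i : ℕ) < d → (A i)ᵀ = A i) (m : Fin (d+1)) :
    (symmetrization A m)ᵀ = symmetrization A m := by
  unfold symmetrization
  split_ifs with h
  · subst h
    rw [Matrix.transpose_add, hT, ← hT, Matrix.transpose_transpose, add_comm]
  · apply hS
    have : (m : ℕ) ≠ d := fun h' => h (Fin.ext h')
    have := m.isLt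
    simp only [Fin.val_castSucc]
    omega

theorem span_symm_aux {X : Type*} {d : ℕ} (B : Fin (d+1) → Matrix X X ℂ)
    (hB : ∀ m, (B m)ᵀ = B m) (M : Matrix X X ℂ)
    (hM : M ∈ Submodule.span ℂ (Set.range B)) : Mᵀ = M := by
  induction hM using Submodule.span_induction with
  | mem x hx => obtain ⟨m, rfl⟩ := hx; exact hB m
  | zero => simp
  | add x y _ _ hx hy => rw [Matrix.transpose_add, hx, hy]
  | smul c x _ hx => rw [Matrix.transpose_smul, hx]

theorem half_aux {X : Type*} [Fintype X] (C F : Matrix X X ℂ)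
    (hF : Fᵀ = F) (hid : F * F = F) (hF0 : F ≠ 0) (x : ℂ)
    (h1 : ∃ u : ℂ, C * F = u • F) (h2 : ∃ v : ℂ, Cᵀ * F = v • F)
    (h3 : (C + Cᵀ) * F = x • F) :
    C * F = (x / 2) • F ∧ Cᵀ * F = (x / 2) • F := by
  obtain ⟨u, hu⟩ := h1
  obtain ⟨v, hv⟩ := h2
  have e1 : F * Cᵀ = u • F := by
    have := congrArg Matrix.transpose hu
    rwa [Matrix.transpose_mul, Matrix.transpose_smul, hF] at this
  have e2 : u • F = v • F := by
    calc u • F = (F * Cᵀ) * F := by rw [e1, smul_mul_assoc, hid]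
      _ = v • F := by rw [mul_assoc, hv, mul_smul_comm, hid]
  have huv : u = v := smul_left_injective ℂ hF0 e2
  have e3 : (u + v) • F = x • F := by rw [← h3, add_mul, hu, hv, add_smul]
  have hx : u + v = x := smul_left_injective ℂ hF0 e3
  have hx2 : x / 2 = u := by rw [← hx, ← huv]; ring
  rw [hx2, hu, hv, huv]
  exact ⟨rfl, rfl⟩

theorem stmt7 {X : Type*} [Fintype X] [DecidableEq X] [Nonempty X]
    {d : ℕ} (A E : Fin (d+2) → Matrix X X ℂ)
    (Et : Fin (d+1) → Matrix X X ℂ) (k a b : Fin (d+1) → ℂ)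
    (hA : IsAssocScheme A)
    (hT : (A ⟨d, by omega⟩)ᵀ = A ⟨d+1, by omega⟩)
    (hS : ∀ i : Fin (d+2), (i : ℕ) < d → (A i)ᵀ = A i)
    (hE : ArePrimIdem A E)
    (hEt : ArePrimIdem (symmetrization A) Et)
    (hAm : IsAmorphic (symmetrization A))
    (hP : HasForm12 (symmetrization A) Et k a b)
    (i j : Fin (d+2)) (hi : i ≠ 0) (hj : j ≠ 0) (hij : i ≠ j)
    (hiEt : ∃ p : Fin (d+1), 1 ≤ (p : ℕ) ∧ (p : ℕ) < d ∧ E i = Et p)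
    (hjEt : ∃ p : Fin (d+1), 1 ≤ (p : ℕ) ∧ (p : ℕ) < d ∧ E j = Et p)
    (r s : Fin (d+1)) (hr : 1 ≤ (r : ℕ) ∧ (r : ℕ) < d) (hs : 1 ≤ (s : ℕ) ∧ (s : ℕ) < d)
    (hri : A r.castSucc * E i = a r • E i)
    (hrj : A r.castSucc * E j = b r • E j)
    (hsi : A s.castSucc * E i = b s • E i)
    (hsj : A s.castSucc * E j = a s • E j) :
    ∀ t : Fin (d+2), t ≠ r.castSucc → t ≠ s.castSucc →
      ∃ c : ℂ, A t * E i = c • E i ∧ A t * E j = c • E j := by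
  intro t htr hts
  by_cases hi0 : E i = 0
  · obtain ⟨c, hc⟩ := hE.2.2.2.2 t j
    exact ⟨c, by simp [hi0], hc⟩
  by_cases hj0 : E j = 0
  · obtain ⟨c, hc⟩ := hE.2.2.2.2 t i
    exact ⟨c, hc, by simp [hj0]⟩
  obtain ⟨p, hp1, hpd, hp⟩ := hiEt
  obtain ⟨q, hq1, hqd, hq⟩ := hjEt
  have hsym : ∀ m : Fin (d+1), (m : ℕ) < d → symmetrization A m = A m.castSucc := by
    intro m hm
    unfold symmetrization
    rw [if_neg]
    rintro rfl
    simp at hm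
  have hne : ∀ m : Fin (d+1), 1 ≤ (m : ℕ) → m ≠ 0 := by
    rintro m hm rfl
    simp at hm
  have hT' : (A (Fin.last d).castSucc)ᵀ = A (Fin.last (d+1)) := hT
  have hps : p = s := by
    by_contra h
    have h1 := (hP s (hne s hs.1)).2.2.1 p (hne p hp1) h
    rw [hsym s hs.2, ← hp, hsi] at h1
    exact (hP s (hne s hs.1)).2.2.2 (smul_left_injective ℂ hi0 h1).symm
  have hqr : q = r := by
    by_contra h
    have h1 := (hP r (hne r hr.1)).2.2.1 q (hne q hq1) h
    rw [hsym r hr.2, ← hq, hrj] at h1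
    exact (hP r (hne r hr.1)).2.2.2 (smul_left_injective ℂ hj0 h1).symm
  subst hps hqr
  by_cases ht0 : t = 0
  · subst ht0
    exact ⟨1, by simp [hA.2.2.1], by simp [hA.2.2.1]⟩
  by_cases htd : (t : ℕ) < d
  · obtain ⟨m, rfl⟩ : ∃ m : Fin (d+1), m.castSucc = t := ⟨⟨t, by omega⟩, rfl⟩
    have hm0 : m ≠ 0 := by rintro rfl; exact ht0 rfl
    have hmd : (m : ℕ) < d := htd
    have h := (hP m hm0).2.2.1
    rw [hsym m hmd] at h
    refine ⟨a m, ?_, ?_⟩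
    · rw [hp]; exact h p (hne p hp1) (by rintro rfl; exact hts rfl)
    · rw [hq]; exact h q (hne q hq1) (by rintro rfl; exact htr rfl)
  have hl0 : Fin.last d ≠ 0 := hne _ (by simp; omega)
  have hsl : symmetrization A (Fin.last d)
      = A (Fin.last d).castSucc + (A (Fin.last d).castSucc)ᵀ := by
    rw [hT']; simp [symmetrization]
  have key : ∀ (n : Fin (d+2)) (m : Fin (d+1)), E n = Et m → E n ≠ 0 → 1 ≤ (m : ℕ) →
      (m : ℕ) < d → A (Fin.last d).castSucc * E n = (a (Fin.last d) / 2) • E n ∧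
      (A (Fin.last d).castSucc)ᵀ * E n = (a (Fin.last d) / 2) • E n := by
    intro n m hnm hn0 hm1 hmd
    apply half_aux _ _ _ _ hn0
    · exact hE.2.2.2.2 _ _
    · rw [hT']; exact hE.2.2.2.2 _ _
    · rw [← hsl, hnm]
      exact (hP _ hl0).2.2.1 m (hne m hm1) (by rintro rfl; simp at hmd)
    · rw [hnm]
      exact span_symm_aux _ (symm_transpose_aux A hT' hS) _ (hEt.1 m)
    · simpa using hE.2.2.1 n n
  obtain ⟨k1, k2⟩ := key i p hp hi0 hp1 hpd
  obtain ⟨k3, k4⟩ := key j q hq hj0 hq1 hqd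
  rw [hT'] at k2 k4
  have : t = (Fin.last d).castSucc ∨ t = Fin.last (d+1) := by
    have := t.isLt
    rcases (by omega : (t : ℕ) = d ∨ (t : ℕ) = d + 1) with h | h
    · left; exact Fin.ext h
    · right; exact Fin.ext h
  rcases this with rfl | rfl
  · exact ⟨_, k1, k3⟩
  · exact ⟨_, k2, k4⟩
end

section
/- Let A_0, A_1, A_2, A_3, A_4 be a commutative association scheme on a finite nonempty set X with A_1ᵀ = A_1, A_2ᵀ = A_2 and A_3ᵀ = A_4, with primitive idempotents E_0, ..., E_4, whose symmetrization (with matrices A_0, A_1, A_2, A_3 + A_4) is amorphic with primitive idempotents ordered Ẽ_0, Ẽ_1, Ẽ_2, Ẽ_3 so that the character table has the form (1.2). If Ẽ_3 is different from each of E_1, E_2, E_3, E_4, then each of the matrices A_1 + A_3 and A_2 + A_3 has exactly 5 distinct eigenvalues. -/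
open Matrix Polynomial

section Helpers

set_option linter.unusedSectionVars false

variable {X : Type*} [Fintype X] [DecidableEq X]

lemma zo_disj {d : ℕ} (A : Fin (d+1) → Matrix X X ℂ) (hz : ∀ i, IsZeroOne (A i))
    (hs : (∑ i, A i) = Matrix.of (fun _ _ => (1:ℂ))) (i l : Fin (d+1)) (x y : X)
    (h : A i x y = 1) (hl : l ≠ i) : A l x y = 0 := by
  have h1 : ∑ m, (A m x y).re = 1 := by
    have := congrArg (fun M : Matrix X X ℂ => (M x y).re) hs
    simpa [Matrix.sum_apply] using this
  have hnn : ∀ m, 0 ≤ (A m x y).re := by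
    intro m
    rcases hz m x y with h | h <;> simp [h]
  rcases hz l x y with h0 | h0
  · exact h0
  · exfalso
    have h2 : ∑ m ∈ ({i, l} : Finset (Fin (d+1))), (A m x y).re ≤ ∑ m, (A m x y).re :=
      Finset.sum_le_sum_of_subset_of_nonneg (Finset.subset_univ _) (fun m _ _ => hnn m)
    rw [Finset.sum_pair hl.symm, h1, h, h0] at h2
    norm_num at h2

lemma exists_entry {B : Matrix X X ℂ} (hz : IsZeroOne B) (hB : B ≠ 0) : ∃ x y, B x y = 1 := by
  by_contra hcon
  push Not at hcon
  apply hB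
  ext x y
  rcases hz x y with h | h
  · simpa using h
  · exact absurd h (hcon x y)

lemma li_A {d : ℕ} (A : Fin (d+1) → Matrix X X ℂ) (hne : ∀ i, A i ≠ 0)
    (hz : ∀ i, IsZeroOne (A i))
    (hs : (∑ i, A i) = Matrix.of (fun _ _ => (1:ℂ))) : LinearIndependent ℂ A := by
  rw [Fintype.linearIndependent_iff]
  intro g hg i
  obtain ⟨x, y, hxy⟩ := exists_entry (hz i) (hne i)
  have := congrArg (fun M : Matrix X X ℂ => M x y) hg
  simp only [Matrix.sum_apply, Matrix.smul_apply, Matrix.zero_apply, smul_eq_mul] at this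
  rw [Finset.sum_eq_single i] at this
  · simpa [hxy] using this
  · intro l _ hl
    rw [zo_disj A hz hs i l x y hxy hl, mul_zero]
  · simp

lemma scal_of_mem {d : ℕ} {A E : Fin (d+1) → Matrix X X ℂ} (hE : ArePrimIdem A E)
    {M : Matrix X X ℂ} (hM : M ∈ Submodule.span ℂ (Set.range A)) (j : Fin (d+1)) :
    ∃ p : ℂ, M * E j = p • E j := by
  induction hM using Submodule.span_induction with
  | mem x hx =>
    obtain ⟨i, rfl⟩ := hx
    exact hE.2.2.2.2 i j
  | zero => exact ⟨0, by simp⟩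
  | add x y _ _ hx hy =>
    obtain ⟨p, hp⟩ := hx
    obtain ⟨q, hq⟩ := hy
    exact ⟨p + q, by rw [add_mul, hp, hq, add_smul]⟩
  | smul c x _ hx =>
    obtain ⟨p, hp⟩ := hx
    exact ⟨c * p, by rw [smul_mul_assoc, hp, smul_smul]⟩

lemma comm_of_mem {d : ℕ} {A : Fin (d+1) → Matrix X X ℂ} (hc : ∀ i j, A i * A j = A j * A i)
    {M N : Matrix X X ℂ} (hM : M ∈ Submodule.span ℂ (Set.range A))
    (hN : N ∈ Submodule.span ℂ (Set.range A)) : M * N = N * M := by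
  induction hM using Submodule.span_induction with
  | mem x hx =>
    obtain ⟨i, rfl⟩ := hx
    induction hN using Submodule.span_induction with
    | mem x hx =>
      obtain ⟨j, rfl⟩ := hx
      exact hc i j
    | zero => simp
    | add x y _ _ hx hy => rw [mul_add, add_mul, hx, hy]
    | smul c x _ hx => rw [smul_mul_assoc, mul_smul_comm, hx]
  | zero => simp
  | add x y _ _ hx hy => rw [mul_add, add_mul, hx, hy]
  | smul c x _ hx => rw [smul_mul_assoc, mul_smul_comm, hx]

lemma prim_ne_zero {d : ℕ} {A E : Fin (d+1) → Matrix X X ℂ} (hli : LinearIndependent ℂ A)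
    (hE : ArePrimIdem A E) (j : Fin (d+1)) : E j ≠ 0 := by
  have hle : Submodule.span ℂ (Set.range A) ≤ Submodule.span ℂ (Set.range E) := by
    intro M hM
    have : M = ∑ j, M * E j := by rw [← Finset.mul_sum, hE.2.2.2.1, mul_one]
    rw [this]
    apply Submodule.sum_mem
    intro j _
    obtain ⟨p, hp⟩ := scal_of_mem hE hM j
    rw [hp]
    exact Submodule.smul_mem _ _ (Submodule.subset_span ⟨j, rfl⟩)
  have : LinearIndependent ℂ E := by
    rw [linearIndependent_iff_card_le_finrank_span]
    rw [linearIndependent_iff_card_le_finrank_span] at hli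
    exact hli.trans (Submodule.finrank_mono hle)
  exact this.ne_zero j

lemma smul_cancel {M : Matrix X X ℂ} (hM : M ≠ 0) {p q : ℂ} (h : p • M = q • M) : p = q :=
  smul_left_injective ℂ hM h

lemma exists_vec {B M : Matrix X X ℂ} {l : ℂ} (hM : M ≠ 0) (h : B * M = l • M) :
    ∃ v : X → ℂ, v ≠ 0 ∧ ∀ x, ∑ y, B x y * v y = l * v x := by
  by_contra hcon
  push Not at hcon
  apply hM
  ext x y
  by_contra hne
  obtain ⟨z, hz⟩ := hcon (fun x => M x y) (fun h0 => hne (congrFun h0 x))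
  apply hz
  have := congrArg (fun N : Matrix X X ℂ => N z y) h
  simpa [Matrix.mul_apply] using this

lemma bound_eig {B M : Matrix X X ℂ} {l k : ℂ} (hz : IsZeroOne B) (hM : M ≠ 0)
    (h : B * M = l • M) (hk : ∀ x, ∑ y, B x y = k) : l.re ≤ k.re := by
  obtain ⟨v, hv, hB⟩ := exists_vec hM h
  obtain ⟨x0, hx0⟩ : ∃ x, v x ≠ 0 := by
    by_contra hcon
    push Not at hcon
    exact hv (funext hcon)
  have : Nonempty X := ⟨x0⟩
  obtain ⟨x, hx⟩ := Finite.exists_max (fun x => ‖v x‖)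
  have hpos : 0 < ‖v x‖ := lt_of_lt_of_le (norm_pos_iff.mpr hx0) (hx x0)
  have hn : ∀ y, ‖B x y‖ = (B x y).re := by
    intro y
    rcases hz x y with h | h <;> simp [h]
  have h1 : ‖l‖ * ‖v x‖ ≤ k.re * ‖v x‖ := by
    rw [← norm_mul, ← hB x]
    refine (norm_sum_le _ _).trans ?_
    have : k.re = ∑ y, ‖B x y‖ := by
      rw [← hk x, Complex.re_sum]
      exact Finset.sum_congr rfl (fun y _ => (hn y).symm)
    rw [this, Finset.sum_mul]
    apply Finset.sum_le_sum
    intro y _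
    rw [norm_mul]
    exact mul_le_mul_of_nonneg_left (hx y) (norm_nonneg _)
  exact (Complex.re_le_norm l).trans (le_of_mul_le_mul_right h1 hpos)

open scoped ComplexOrder in
lemma herm_eig {B M : Matrix X X ℂ} {l : ℂ} (hH : Bᴴ = B) (hM : M ≠ 0)
    (h : B * M = l • M) : l.im = 0 := by
  have h1 : Mᴴ * B * M = l • (Mᴴ * M) := by rw [mul_assoc, h, mul_smul_comm]
  have h2 : Mᴴ * B * M = (star l) • (Mᴴ * M) := by
    have := congrArg Matrix.conjTranspose h
    rw [conjTranspose_mul, conjTranspose_smul, hH] at this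
    rw [this, smul_mul_assoc]
  have h3 : Mᴴ * M ≠ 0 := by
    rw [Ne, Matrix.conjTranspose_mul_self_eq_zero]
    exact hM
  have h4 := smul_cancel h3 (h1.symm.trans h2)
  exact Complex.conj_eq_iff_im.mp h4.symm

lemma zo_herm {B : Matrix X X ℂ} (hz : IsZeroOne B) : Bᴴ = Bᵀ := by
  ext x y
  rcases hz y x with h | h <;> simp [h]

lemma eig_card {ι : Type*} [Fintype ι] [DecidableEq ι] (B : Matrix X X ℂ) (e : ι → Matrix X X ℂ)
    (β : ι → ℂ) (hne : ∀ i, e i ≠ 0) (hs : ∑ i, e i = 1) (hB : ∀ i, B * e i = β i • e i)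
    (hc : ∀ i, B * e i = e i * B) (hinj : Function.Injective β) :
    numDistinctEigen B = Fintype.card ι := by
  have key : B.charpoly.roots.toFinset = Finset.univ.image β := by
    ext μ
    rw [Multiset.mem_toFinset, Polynomial.mem_roots (Matrix.charpoly_monic B).ne_zero,
      ← Matrix.mem_spectrum_iff_isRoot_charpoly, ← Matrix.spectrum_toLin',
      ← Module.End.hasEigenvalue_iff_mem_spectrum]
    simp only [Finset.mem_image, Finset.mem_univ, true_and]
    constructor
    · intro h
      obtain ⟨v, hv⟩ := h.exists_hasEigenvector
      have hv1 : B *ᵥ v = μ • v := by simpa using hv.apply_eq_smul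
      have hv2 : v ≠ 0 := hv.2
      obtain ⟨i, hi⟩ : ∃ i, e i *ᵥ v ≠ 0 := by
        by_contra hcon
        push Not at hcon
        apply hv2
        have : (∑ i, e i) *ᵥ v = v := by rw [hs, one_mulVec]
        rw [← this, Matrix.sum_mulVec]
        exact Finset.sum_eq_zero (fun i _ => hcon i)
      refine ⟨i, ?_⟩
      have h1 : (B * e i) *ᵥ v = β i • (e i *ᵥ v) := by rw [hB, smul_mulVec]
      have h2 : (B * e i) *ᵥ v = μ • (e i *ᵥ v) := by
        rw [hc, ← mulVec_mulVec, hv1, mulVec_smul]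
      exact smul_left_injective ℂ hi (h1.symm.trans h2)
    · rintro ⟨i, rfl⟩
      obtain ⟨v, hv, hBv⟩ := exists_vec (hne i) (hB i)
      apply Module.End.hasEigenvalue_of_hasEigenvector (x := v)
      refine ⟨?_, hv⟩
      rw [Module.End.mem_eigenspace_iff]
      ext x
      simpa [Matrix.mulVec, dotProduct] using hBv x
  rw [numDistinctEigen, key, Finset.card_image_of_injective _ hinj, Finset.card_univ]

lemma ext_e {e : Fin 5 → Matrix X X ℂ} (hs : ∑ i, e i = 1) {M N : Matrix X X ℂ}
    (h : ∀ i, M * e i = N * e i) : M = N := by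
  rw [← mul_one M, ← mul_one N, ← hs, Finset.mul_sum, Finset.mul_sum]
  exact Finset.sum_congr rfl (fun i _ => h i)

lemma core [Nonempty X] (A1 A2 S C : Matrix X X ℂ) (e : Fin 5 → Matrix X X ℂ)
    (k1 k2 k3 a1 a2 a3 b1 b3 b2 c : ℂ)
    (z1 : IsZeroOne A1) (z3 : IsZeroOne S) (s1 : A1ᵀ = A1) (s3 : Sᵀ = S)
    (n1 : A1 ≠ 0) (n3 : S ≠ 0) (hC : Cᴴ = -C)
    (hd1 : ∀ x, A1 x x = 0) (hd3 : ∀ x, S x x = 0) (hd : ∀ x y, A1 x y * S x y = 0)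
    (hJ : 1 + A1 + A2 + S = Matrix.of (fun _ _ => (1:ℂ)))
    (hJ0 : e 0 = ((Fintype.card X : ℂ))⁻¹ • Matrix.of (fun _ _ => (1:ℂ)))
    (ho : ∀ i, i ≠ 0 → e 0 * e i = 0)
    (hne : ∀ i, e i ≠ 0) (hs : ∑ i, e i = 1)
    (h1 : ∀ i, A1 * e i = (![k1, b1, a1, a1, a1] i) • e i)
    (h2 : ∀ i, A2 * e i = (![k2, a2, b2, a2, a2] i) • e i)
    (h3 : ∀ i, S * e i = (![k3, a3, a3, b3, b3] i) • e i)
    (h4 : ∀ i, C * e i = (![0, 0, 0, c, -c] i) • e i)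
    (hc : ∀ i, (A1 + (1/2 : ℂ) • (S + C)) * e i = e i * (A1 + (1/2 : ℂ) • (S + C)))
    (hab : a1 ≠ b1) (hc0 : c ≠ 0) :
    numDistinctEigen (A1 + (1/2 : ℂ) • (S + C)) = 5 := by
  have hcard : (Fintype.card X : ℂ) ≠ 0 := by
    exact_mod_cast Fintype.card_ne_zero
  have hrow : ∀ (B : Matrix X X ℂ) (k : ℂ), B * e 0 = k • e 0 → ∀ x, ∑ y, B x y = k := by
    intro B k h x
    rw [hJ0] at h
    have := congrArg (fun N : Matrix X X ℂ => N x x) h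
    simp only [Matrix.mul_apply, Matrix.smul_apply, Matrix.of_apply, smul_eq_mul, mul_one] at this
    rw [← Finset.sum_mul] at this
    exact mul_right_cancel₀ (inv_ne_zero hcard) this
  have r1 := hrow A1 k1 (by simpa using h1 0)
  have r3 := hrow S k3 (by simpa using h3 0)
  have hpos : ∀ (B : Matrix X X ℂ) (k : ℂ), IsZeroOne B → B ≠ 0 → (∀ x, ∑ y, B x y = k) →
      0 < k.re := by
    intro B k hz hB hk
    obtain ⟨x, y, hxy⟩ := exists_entry hz hB
    rw [← hk x, Complex.re_sum]
    apply Finset.sum_pos'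
    · intro y _
      rcases hz x y with h | h <;> simp [h]
    · exact ⟨y, Finset.mem_univ _, by simp [hxy]⟩
  have p1 := hpos A1 k1 z1 n1 r1
  have p3 := hpos S k3 z3 n3 r3
  have H1 : A1ᴴ = A1 := (zo_herm z1).trans s1
  have H3 : Sᴴ = S := (zo_herm z3).trans s3
  have ik1 : k1.im = 0 := herm_eig H1 (hne 0) (by simpa using h1 0)
  have ib1 : b1.im = 0 := herm_eig H1 (hne 1) (by simpa using h1 1)
  have ia1 : a1.im = 0 := herm_eig H1 (hne 2) (by simpa using h1 2)
  have ik3 : k3.im = 0 := herm_eig H3 (hne 0) (by simpa using h3 0)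
  have ia3 : a3.im = 0 := herm_eig H3 (hne 1) (by simpa using h3 1)
  have ib3 : b3.im = 0 := herm_eig H3 (hne 3) (by simpa using h3 3)
  have lb1 : b1.re ≤ k1.re := bound_eig z1 (hne 1) (by simpa using h1 1) r1
  have la1 : a1.re ≤ k1.re := bound_eig z1 (hne 2) (by simpa using h1 2) r1
  have la3 : a3.re ≤ k3.re := bound_eig z3 (hne 1) (by simpa using h3 1) r3
  have lb3 : b3.re ≤ k3.re := bound_eig z3 (hne 3) (by simpa using h3 3) r3
  have ic : c.re = 0 := by
    have : ((Complex.I • C) : Matrix X X ℂ)ᴴ = Complex.I • C := by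
      rw [conjTranspose_smul, hC]
      simp
    have h := herm_eig (l := Complex.I * c) this (hne 3) (by
      have := h4 3
      simp at this
      rw [smul_mul_assoc, this, smul_smul])
    simpa using h
  have hcim : c.im ≠ 0 := fun h => hc0 (Complex.ext ic h)
  -- sum relations
  have hsum : ∀ i, i ≠ 0 → 1 + (![k1, b1, a1, a1, a1] i) + (![k2, a2, b2, a2, a2] i)
      + (![k3, a3, a3, b3, b3] i) = 0 := by
    intro i hi
    have hJe : Matrix.of (fun _ _ => (1:ℂ)) * e i = 0 := by
      have h := ho i hi
      rw [hJ0, smul_mul_assoc] at h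
      exact (smul_eq_zero.mp h).resolve_left (inv_ne_zero hcard)
    rw [← hJ, add_mul, add_mul, add_mul, h1, h2, h3, one_mul] at hJe
    apply smul_cancel (hne i)
    rw [zero_smul, ← hJe]
    simp only [add_smul, one_smul]
  have t1 : 1 + b1 + a2 + a3 = 0 := by simpa using hsum 1 (by decide)
  have t3 : 1 + a1 + a2 + b3 = 0 := by simpa using hsum 3 (by decide)
  -- diagonal relation
  have hdiag : ∀ u w : ℂ, A1 * S = u • S + w • A1 - (u * w) • (1 : Matrix X X ℂ) →
      u * w = 0 := by
    intro u w h
    obtain ⟨x⟩ := ‹Nonempty X›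
    have := congrArg (fun N : Matrix X X ℂ => N x x) h
    simp only [Matrix.mul_apply, Matrix.sub_apply, Matrix.add_apply, Matrix.smul_apply,
      Matrix.one_apply_eq, hd1, hd3, smul_eq_mul, mul_zero, mul_one] at this
    rw [Finset.sum_eq_zero] at this
    · linear_combination this
    · intro y _
      have hy : S y x = S x y := congrFun (congrFun s3 x) y
      rw [hy]
      exact hd x y
  have hprod : ∀ u w : ℂ, (∀ i, (![k1, b1, a1, a1, a1] i - u) * (![k3, a3, a3, b3, b3] i - w) = 0) →
      u * w = 0 := by
    intro u w h
    apply hdiag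
    apply ext_e hs
    intro i
    have hi := h i
    rw [mul_assoc, h3, mul_smul_comm, h1, sub_mul, add_mul, smul_mul_assoc, smul_mul_assoc,
      smul_mul_assoc, h1, h3, one_mul, smul_smul, smul_smul, smul_smul, ← add_smul, ← sub_smul]
    congr 1
    linear_combination hi
  have nA : ¬ (k1 = a1 ∧ k3 = a3) := by
    rintro ⟨rfl, rfl⟩
    have := hprod k1 k3 (by intro i; fin_cases i <;> simp)
    rcases mul_eq_zero.mp this with h | h
    · rw [h] at p1; simp at p1
    · rw [h] at p3; simp at p3
  have nB : ¬ (k1 = b1 ∧ k3 = a3) := by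
    rintro ⟨rfl, rfl⟩
    have := hprod a1 k3 (by intro i; fin_cases i <;> simp)
    rcases mul_eq_zero.mp this with h | h
    · have h5 : b3 = k1 + k3 := by linear_combination t3 - t1 - h
      rw [h5, Complex.add_re] at lb3
      linarith
    · rw [h] at p3; simp at p3
  have q0 : k1 + 1/2 * k3 ≠ b1 + 1/2 * a3 := by
    intro h
    have hr := congrArg Complex.re h
    norm_num at hr
    exact nB ⟨Complex.ext (by linarith) (by rw [ik1, ib1]),
      Complex.ext (by linarith) (by rw [ik3, ia3])⟩
  have q1 : k1 + 1/2 * k3 ≠ a1 + 1/2 * a3 := by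
    intro h
    have hr := congrArg Complex.re h
    norm_num at hr
    exact nA ⟨Complex.ext (by linarith) (by rw [ik1, ia1]),
      Complex.ext (by linarith) (by rw [ik3, ia3])⟩
  have q2 : b1 + 1/2 * a3 ≠ a1 + 1/2 * a3 := fun h => hab (by linear_combination -h)
  have q3 : ∀ z c' : ℂ, z.im = 0 → c'.im ≠ 0 → z ≠ a1 + 1/2 * (b3 + c') := by
    intro z c' hz hc' h
    have hr := congrArg Complex.im h
    norm_num [hz, ia1, ib3] at hr
    exact hc' hr
  have q4 : a1 + 1/2 * (b3 + c) ≠ a1 + 1/2 * (b3 + -c) := fun h => hc0 (by linear_combination h)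
  have hcim' : (-c).im ≠ 0 := by simpa using hcim
  have i0 : (k1 + 1/2 * k3).im = 0 := by norm_num [ik1, ik3]
  have i1 : (b1 + 1/2 * a3).im = 0 := by norm_num [ib1, ia3]
  have i2 : (a1 + 1/2 * a3).im = 0 := by norm_num [ia1, ia3]
  have := eig_card (A1 + (1/2 : ℂ) • (S + C)) e
    ![k1 + 1/2 * k3, b1 + 1/2 * a3, a1 + 1/2 * a3, a1 + 1/2 * (b3 + c), a1 + 1/2 * (b3 + -c)]
    hne hs ?_ hc ?_
  · simpa using this
  · intro i
    rw [add_mul, smul_mul_assoc, add_mul, h1, h3, h4, ← add_smul, smul_smul, ← add_smul]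
    congr 1
    fin_cases i <;> simp
  · have w1 := q3 _ c i0 hcim
    have w2 := q3 _ c i1 hcim
    have w3 := q3 _ c i2 hcim
    have w4 := q3 _ (-c) i0 hcim'
    have w5 := q3 _ (-c) i1 hcim'
    have w6 := q3 _ (-c) i2 hcim'
    generalize k1 + 1/2 * k3 = y0 at *
    generalize b1 + 1/2 * a3 = y1 at *
    generalize a1 + 1/2 * a3 = y2 at *
    generalize a1 + 1/2 * (b3 + c) = y3 at *
    generalize a1 + 1/2 * (b3 + -c) = y4 at *
    intro i j hij
    fin_cases i <;> fin_cases j <;> simp at hij ⊢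
    all_goals first
      | exact absurd hij (by assumption)
      | exact absurd hij.symm (by assumption)

lemma comb (f : Fin 5 → Fin 4) (h0 : f 0 = 0) (hsurj : ∀ i, ∃ j, f j = i)
    (h3 : ¬ ∃ j, f j = 3 ∧ ∀ l, f l = 3 → l = j) :
    ∃ σ : Fin 5 → Fin 5, Function.Bijective σ ∧ σ 0 = 0 ∧ f (σ 1) = 1 ∧ f (σ 2) = 2 ∧
      f (σ 3) = 3 ∧ f (σ 4) = 3 := by
  obtain ⟨p, hp⟩ := hsurj 1
  obtain ⟨q, hq⟩ := hsurj 2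
  obtain ⟨r, hr⟩ := hsurj 3
  obtain ⟨s, hs, hsr⟩ : ∃ s, f s = 3 ∧ s ≠ r := by
    by_contra hcon
    push Not at hcon
    exact h3 ⟨r, hr, hcon⟩
  refine ⟨![0, p, q, r, s], ?_, rfl, hp, hq, hr, hs⟩
  rw [← Finite.injective_iff_bijective]
  have hh : ∀ x y, f x ≠ f y → x ≠ y := fun x y h e => h (by rw [e])
  have e1 := hh 0 p (by rw [h0, hp]; decide)
  have e2 := hh 0 q (by rw [h0, hq]; decide)
  have e3 := hh 0 r (by rw [h0, hr]; decide)
  have e4 := hh 0 s (by rw [h0, hs]; decide)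
  have e5 := hh p q (by rw [hp, hq]; decide)
  have e6 := hh p r (by rw [hp, hr]; decide)
  have e7 := hh p s (by rw [hp, hs]; decide)
  have e8 := hh q r (by rw [hq, hr]; decide)
  have e9 := hh q s (by rw [hq, hs]; decide)
  intro i j hij
  fin_cases i <;> fin_cases j <;> simp at hij ⊢
  all_goals first
    | exact absurd hij (by assumption)
    | exact absurd hij.symm (by assumption)

end Helpers

theorem stmt10 {X : Type*} [Fintype X] [DecidableEq X] [Nonempty X]
    (A E : Fin 5 → Matrix X X ℂ) (Et : Fin 4 → Matrix X X ℂ) (k a b : Fin 4 → ℂ)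
    (hA : IsAssocScheme A)
    (h1 : (A 1)ᵀ = A 1) (h2 : (A 2)ᵀ = A 2) (h34 : (A 3)ᵀ = A 4)
    (hE : ArePrimIdem A E)
    (hEt : ArePrimIdem (symmetrization (d := 3) A) Et)
    (hAm : IsAmorphic (symmetrization (d := 3) A))
    (hP : HasForm12 (symmetrization (d := 3) A) Et k a b)
    (hnotin : ∀ j : Fin 5, j ≠ 0 → Et 3 ≠ E j) :
    numDistinctEigen (A 1 + A 3) = 5 ∧ numDistinctEigen (A 2 + A 3) = 5 := by
  obtain ⟨hne, hz, hA0, hsum, -, hcomm, -⟩ := hA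
  obtain ⟨S, hS⟩ : ∃ S, S = A 3 + A 4 := ⟨_, rfl⟩
  obtain ⟨C, hC⟩ : ∃ C, C = A 3 - A 4 := ⟨_, rfl⟩
  have hA3 : A 3 = (1/2 : ℂ) • (S + C) := by
    rw [hS, hC]; module
  have h43 : (A 4)ᵀ = A 3 := by rw [← h34, transpose_transpose]
  have hsy : symmetrization (d := 3) A = ![A 0, A 1, A 2, S] := by
    funext i
    fin_cases i
    · rfl
    · rfl
    · rfl
    · simp [symmetrization, hS]
  rw [hsy] at hEt hP
  clear hAm hsy
  have disj := zo_disj A hz hsum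
  -- facts on S
  have zS : IsZeroOne S := by
    intro x y
    rw [hS, Matrix.add_apply]
    rcases hz 3 x y with h | h
    · rw [h, zero_add]; exact hz 4 x y
    · rw [h, disj 3 4 x y h (by decide)]; simp
  have nS : S ≠ 0 := by
    intro h0
    obtain ⟨x, y, hxy⟩ := exists_entry (hz 3) (hne 3)
    have h4 := disj 3 4 x y hxy (by decide)
    have := congrFun (congrFun h0 x) y
    rw [hS, Matrix.add_apply, hxy, h4] at this
    simp at this
  have nC : C ≠ 0 := by
    intro h0
    obtain ⟨x, y, hxy⟩ := exists_entry (hz 3) (hne 3)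
    have h4 := disj 3 4 x y hxy (by decide)
    have := congrFun (congrFun h0 x) y
    rw [hC, Matrix.sub_apply, hxy, h4] at this
    simp at this
  have sS : Sᵀ = S := by rw [hS, transpose_add, h34, h43, add_comm]
  have sC : Cᵀ = -C := by rw [hC, transpose_sub, h34, h43, neg_sub]
  have sC' : Cᴴ = -C := by
    rw [hC, conjTranspose_sub, zo_herm (hz 3), zo_herm (hz 4), h34, h43, neg_sub]
  have hsumS : A 0 + A 1 + A 2 + S = Matrix.of (fun _ _ => (1:ℂ)) := by
    rw [← hsum, Fin.sum_univ_five, hS, ← add_assoc]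
  have liA := li_A A hne hz hsum
  have liS : LinearIndependent ℂ ![A 0, A 1, A 2, S] := by
    apply li_A (d := 3)
    · intro i; fin_cases i
      · exact hne 0
      · exact hne 1
      · exact hne 2
      · exact nS
    · intro i; fin_cases i
      · exact hz 0
      · exact hz 1
      · exact hz 2
      · exact zS
    · rw [Fin.sum_univ_four]; exact hsumS
  have Ene := prim_ne_zero liA hE
  have Etne := prim_ne_zero (d := 3) liS hEt
  have mA : ∀ i, A i ∈ Submodule.span ℂ (Set.range A) := fun i => Submodule.subset_span ⟨i, rfl⟩
  have mS : S ∈ Submodule.span ℂ (Set.range A) := by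
    rw [hS]; exact Submodule.add_mem _ (mA 3) (mA 4)
  have mC : C ∈ Submodule.span ℂ (Set.range A) := by
    rw [hC]; exact Submodule.sub_mem _ (mA 3) (mA 4)
  have hle : Submodule.span ℂ (Set.range ![A 0, A 1, A 2, S]) ≤
      Submodule.span ℂ (Set.range A) := by
    rw [Submodule.span_le]
    rintro _ ⟨i, rfl⟩
    fin_cases i
    · exact mA 0
    · exact mA 1
    · exact mA 2
    · exact mS
  have mEt : ∀ i, Et i ∈ Submodule.span ℂ (Set.range A) := fun i => hle (hEt.1 i)
  have symN : ∀ M ∈ Submodule.span ℂ (Set.range ![A 0, A 1, A 2, S]), Mᵀ = M := by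
    intro M hM
    induction hM using Submodule.span_induction with
    | mem x hx =>
      obtain ⟨i, rfl⟩ := hx
      fin_cases i
      · simp [hA0]
      · exact h1
      · exact h2
      · exact sS
    | zero => simp
    | add x y _ _ hx hy => rw [transpose_add, hx, hy]
    | smul c x _ hx => rw [transpose_smul, hx]
  have mN : ∀ M ∈ Submodule.span ℂ (Set.range A),
      M + Mᵀ ∈ Submodule.span ℂ (Set.range ![A 0, A 1, A 2, S]) := by
    intro M hM
    have g : ∀ i, ![A 0, A 1, A 2, S] i ∈ Submodule.span ℂ (Set.range ![A 0, A 1, A 2, S]) :=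
      fun i => Submodule.subset_span ⟨i, rfl⟩
    induction hM using Submodule.span_induction with
    | mem x hx =>
      obtain ⟨i, rfl⟩ := hx
      fin_cases i
      · have : (A 0)ᵀ = A 0 := by rw [hA0, transpose_one]
        simp only [Fin.zero_eta, this]
        exact Submodule.add_mem _ (g 0) (g 0)
      · show A 1 + (A 1)ᵀ ∈ _
        rw [h1]
        exact Submodule.add_mem _ (g 1) (g 1)
      · show A 2 + (A 2)ᵀ ∈ _
        rw [h2]
        exact Submodule.add_mem _ (g 2) (g 2)
      · show A 3 + (A 3)ᵀ ∈ _
        rw [h34, ← hS]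
        exact g 3
      · show A 4 + (A 4)ᵀ ∈ _
        rw [h43, add_comm, ← hS]
        exact g 3
    | zero => simp
    | add x y _ _ hx hy =>
      rw [transpose_add, add_add_add_comm]
      exact Submodule.add_mem _ hx hy
    | smul c x _ hx =>
      rw [transpose_smul, ← smul_add]
      exact Submodule.smul_mem _ _ hx
  -- the fusion map
  obtain ⟨-, hE0, hEo, hEs, -⟩ := id hE
  obtain ⟨-, hEt0, hEto, hEts, -⟩ := id hEt
  have hf : ∀ j, ∃ i, Et i * E j = E j := by
    intro j
    by_contra hcon
    push Not at hcon
    have hz0 : ∀ i, Et i * E j = 0 := by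
      intro i
      obtain ⟨p, hp⟩ := scal_of_mem hE (mEt i) j
      have h5 : (Et i * Et i) * E j = Et i * E j := by rw [hEto, if_pos rfl]
      rw [mul_assoc, hp, mul_smul_comm, hp, smul_smul] at h5
      have h6 := smul_cancel (Ene j) h5
      have h7 : p * (p - 1) = 0 := by linear_combination h6
      rcases mul_eq_zero.mp h7 with h | h
      · rw [hp, h, zero_smul]
      · exact absurd (by rw [hp, sub_eq_zero.mp h, one_smul]) (hcon i)
    apply Ene j
    rw [← one_mul (E j), ← hEts, Finset.sum_mul]
    exact Finset.sum_eq_zero (fun i _ => hz0 i)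
  choose f hf using hf
  have hf' : ∀ i j, Et i * E j = if f j = i then E j else 0 := by
    intro i j
    split_ifs with h
    · rw [← h, hf]
    · rw [← hf j, ← mul_assoc, hEto, if_neg (fun h' => h h'.symm), zero_mul]
  have hEtsum : ∀ i, Et i = ∑ j, if f j = i then E j else 0 := by
    intro i
    conv_lhs => rw [← mul_one (Et i), ← hEs, Finset.mul_sum]
    exact Finset.sum_congr rfl (fun j _ => hf' i j)
  have hf0 : f 0 = 0 := by
    by_contra h
    have h5 := hf' 0 0
    rw [if_neg h, hEt0, ← hE0, hEo, if_pos rfl] at h5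
    exact Ene 0 h5
  obtain ⟨σ, hσ, σ0, σ1, σ2, σ3, σ4⟩ := comb f hf0 (by
    intro i
    by_contra hcon
    push Not at hcon
    apply Etne i
    rw [hEtsum]
    exact Finset.sum_eq_zero (fun j _ => if_neg (hcon j))) (by
    rintro ⟨j, hj, hu⟩
    apply hnotin j
    · rintro rfl
      rw [hf0] at hj
      exact absurd hj (by decide)
    · rw [hEtsum, Finset.sum_eq_single j]
      · rw [if_pos hj]
      · intro l _ hl
        exact if_neg (fun h => hl (hu l h))
      · simp)
  obtain ⟨e, he⟩ : ∃ e : Fin 5 → Matrix X X ℂ, e = fun i => E (σ i) := ⟨_, rfl⟩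
  have ene : ∀ i, e i ≠ 0 := fun i => by rw [he]; exact Ene _
  have es : ∑ i, e i = 1 := by
    rw [he, ← hEs]
    exact Function.Bijective.sum_comp hσ E
  have e0 : e 0 = ((Fintype.card X : ℂ))⁻¹ • Matrix.of (fun _ _ => (1:ℂ)) := by
    rw [he]; simp only [σ0]; exact hE0
  have eo : ∀ i, i ≠ 0 → e 0 * e i = 0 := by
    intro i hi
    rw [he]
    simp only [hEo]
    exact if_neg (fun h => hi (hσ.1 h).symm)
  have me : ∀ i, e i ∈ Submodule.span ℂ (Set.range A) := fun i => by rw [he]; exact hE.1 _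
  have ef : ∀ i, Et (![0, 1, 2, 3, 3] i) * e i = e i := by
    intro i
    rw [he]
    have h5 : f (σ i) = ![0, 1, 2, 3, 3] i := by
      fin_cases i
      · simpa [σ0] using hf0
      · exact σ1
      · exact σ2
      · exact σ3
      · exact σ4
    rw [← h5]
    exact hf _
  have tr : ∀ (M : Matrix X X ℂ) (p : ℂ) (i : Fin 5),
      M * Et (![0, 1, 2, 3, 3] i) = p • Et (![0, 1, 2, 3, 3] i) → M * e i = p • e i := by
    intro M p i h
    rw [← ef i, ← mul_assoc, h, smul_mul_assoc]
  -- eigenvalues of C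
  have Ceig : ∀ i, ∃ c : ℂ, C * e i = c • e i := by
    intro i
    rw [he]
    exact scal_of_mem hE mC _
  choose γ hγ using Ceig
  have oEt : ∀ m i, Et m * e i = if ![0, 1, 2, 3, 3] i = m then e i else 0 := by
    intro m i
    split_ifs with h
    · rw [← h, ef]
    · rw [← ef i, ← mul_assoc, hEto, if_neg (fun h' => h h'.symm), zero_mul]
  have Et_e : ∀ m, Et m = ∑ i, if ![0, 1, 2, 3, 3] i = m then e i else 0 := by
    intro m
    conv_lhs => rw [← mul_one (Et m), ← es, Finset.mul_sum]
    exact Finset.sum_congr rfl (fun j _ => oEt m j)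
  have Et0 : Et 0 = e 0 := by rw [Et_e, Fin.sum_univ_five]; simp
  have Et1 : Et 1 = e 1 := by rw [Et_e, Fin.sum_univ_five]; simp
  have Et2 : Et 2 = e 2 := by rw [Et_e, Fin.sum_univ_five]; simp
  have Et3 : Et 3 = e 3 + e 4 := by rw [Et_e, Fin.sum_univ_five]; simp
  have skew : ∀ (M : Matrix X X ℂ) (c : ℂ), Mᵀ = M → M ∈ Submodule.span ℂ (Set.range A) →
      C * M = c • M → C * M = 0 := by
    intro M c hM hMm h
    have h5 := congrArg Matrix.transpose h
    rw [transpose_mul, sC, hM, transpose_smul, hM, mul_neg, ← comm_of_mem hcomm mC hMm, ← h] at h5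
    have h6 : (2 : ℂ) • (C * M) = 0 := by
      rw [two_smul]; nth_rewrite 1 [← h5]; simp
    exact (smul_eq_zero.mp h6).resolve_left two_ne_zero
  have C0 : C * e 0 = 0 := skew (e 0) (γ 0) (by rw [← Et0]; exact symN _ (hEt.1 _)) (me 0) (hγ 0)
  have C1 : C * e 1 = 0 := skew (e 1) (γ 1) (by rw [← Et1]; exact symN _ (hEt.1 _)) (me 1) (hγ 1)
  have C2 : C * e 2 = 0 := skew (e 2) (γ 2) (by rw [← Et2]; exact symN _ (hEt.1 _)) (me 2) (hγ 2)
  have Csum : C = C * Et 3 := by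
    conv_lhs => rw [← mul_one C, ← es, Finset.mul_sum, Fin.sum_univ_five, C0, C1, C2]
    rw [Et3, mul_add]
    simp
  have hne34 : γ 3 ≠ γ 4 := by
    intro h
    apply nC
    rw [Csum]
    apply skew (Et 3) (γ 3) (symN _ (hEt.1 _)) (mEt 3)
    rw [Et3, mul_add, hγ, hγ, ← h, smul_add]
  have hsq : γ 3 * γ 3 = γ 4 * γ 4 := by
    have sqT : (C * C)ᵀ = C * C := by rw [transpose_mul, sC]; simp
    -- C * C lies in the full algebra
    have mCC : C * C ∈ Submodule.span ℂ (Set.range A) := by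
      have h5 : C * C = ∑ i, (γ i * γ i) • e i := by
        conv_lhs => rw [← mul_one (C * C), ← es, Finset.mul_sum]
        refine Finset.sum_congr rfl (fun i _ => ?_)
        rw [mul_assoc, hγ, mul_smul_comm, hγ, smul_smul]
      rw [h5]
      exact Submodule.sum_mem _ (fun i _ => Submodule.smul_mem _ _ (me i))
    have h6 := mN _ mCC
    rw [sqT] at h6
    obtain ⟨p, hp⟩ := scal_of_mem (d := 3) hEt h6 3
    have key : ∀ i : Fin 5, ![0, 1, 2, 3, 3] i = (3 : Fin 4) → 2 * (γ i * γ i) = p := by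
      intro i hi
      have h7 := tr _ p i (by rw [hi]; exact hp)
      rw [add_mul, mul_assoc, hγ, mul_smul_comm, hγ, smul_smul, ← add_smul] at h7
      rw [two_mul]
      exact smul_cancel (ene i) h7
    have k3 := key 3 rfl
    have k4 := key 4 rfl
    linear_combination (k3 - k4) / 2
  have hneg : γ 4 = - γ 3 := by
    have h5 : (γ 3 - γ 4) * (γ 4 + γ 3) = 0 := by linear_combination hsq
    rcases mul_eq_zero.mp h5 with h | h
    · exact absurd (sub_eq_zero.mp h) hne34
    · exact eq_neg_of_add_eq_zero_left h
  have hc0 : γ 3 ≠ 0 := by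
    intro h
    apply hne34
    rw [hneg, h, neg_zero]
  -- eigenvalues
  obtain ⟨u10, u11, u1, ab1⟩ := hP 1 (by decide)
  obtain ⟨u20, u22, u2, ab2⟩ := hP 2 (by decide)
  obtain ⟨u30, u33, u3, ab3⟩ := hP 3 (by decide)
  have v1 : ∀ i, A 1 * e i = (![k 1, b 1, a 1, a 1, a 1] i) • e i := by
    intro i
    apply tr
    fin_cases i
    · exact u10
    · exact u11
    · exact u1 2 (by decide) (by decide)
    · exact u1 3 (by decide) (by decide)
    · exact u1 3 (by decide) (by decide)
  have v2 : ∀ i, A 2 * e i = (![k 2, a 2, b 2, a 2, a 2] i) • e i := by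
    intro i
    apply tr
    fin_cases i
    · exact u20
    · exact u2 1 (by decide) (by decide)
    · exact u22
    · exact u2 3 (by decide) (by decide)
    · exact u2 3 (by decide) (by decide)
  have v3 : ∀ i, S * e i = (![k 3, a 3, a 3, b 3, b 3] i) • e i := by
    intro i
    apply tr
    fin_cases i
    · exact u30
    · exact u3 1 (by decide) (by decide)
    · exact u3 2 (by decide) (by decide)
    · exact u33
    · exact u33
  have v4 : ∀ i, C * e i = (![0, 0, 0, γ 3, -γ 3] i) • e i := by
    intro i
    fin_cases i
    · simpa using C0
    · simpa using C1
    · simpa using C2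
    · exact hγ 3
    · show C * e 4 = (-γ 3) • e 4
      rw [← hneg]; exact hγ 4
  have d0 : ∀ x i, i ≠ 0 → A i x x = 0 := fun x i hi => disj 0 i x x (by simp [hA0]) hi
  have dS : ∀ x, S x x = 0 := by
    intro x
    rw [hS, Matrix.add_apply, d0 x 3 (by decide), d0 x 4 (by decide), add_zero]
  have dd : ∀ i, i ≠ 3 → i ≠ 4 → ∀ x y, A i x y * S x y = 0 := by
    intro i hi3 hi4 x y
    rcases hz i x y with h | h
    · rw [h, zero_mul]
    · rw [hS, Matrix.add_apply, disj i 3 x y h hi3.symm, disj i 4 x y h hi4.symm]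
      simp
  have cm : ∀ i l, (A i + (1/2 : ℂ) • (S + C)) * e l = e l * (A i + (1/2 : ℂ) • (S + C)) :=
    fun i l => comm_of_mem hcomm (Submodule.add_mem _ (mA i)
      (Submodule.smul_mem _ _ (Submodule.add_mem _ mS mC))) (me l)
  rw [hA3]
  constructor
  · exact core (A 1) (A 2) S C e (k 1) (k 2) (k 3) (a 1) (a 2) (a 3) (b 1) (b 3) (b 2) (γ 3)
      (hz 1) zS h1 sS (hne 1) nS sC' (fun x => d0 x 1 (by decide)) dS
      (dd 1 (by decide) (by decide)) (by rw [← hsumS, hA0]) e0 eo ene es v1 v2 v3 v4 (cm 1)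
      ab1 hc0
  · refine core (A 2) (A 1) S C (fun i => e (Equiv.swap 1 2 i)) (k 2) (k 1) (k 3) (a 2) (a 1) (a 3)
      (b 2) (b 3) (b 1) (γ 3)
      (hz 2) zS h2 sS (hne 2) nS sC' (fun x => d0 x 2 (by decide)) dS
      (dd 2 (by decide) (by decide)) (by rw [← hsumS, hA0]; abel) e0 ?_ (fun i => ene _) ?_
      ?_ ?_ ?_ ?_ (fun i => cm 2 _) ab2 hc0
    · intro i hi
      show e 0 * e (Equiv.swap 1 2 i) = 0
      apply eo
      revert hi; revert i; decide
    · rw [← es]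
      exact Equiv.sum_comp (Equiv.swap (1 : Fin 5) 2) e
    · intro i
      fin_cases i
      · exact v2 0
      · exact v2 2
      · exact v2 1
      · exact v2 3
      · exact v2 4
    · intro i
      fin_cases i
      · exact v1 0
      · exact v1 2
      · exact v1 1
      · exact v1 3
      · exact v1 4
    · intro i
      fin_cases i
      · exact v3 0
      · exact v3 2
      · exact v3 1
      · exact v3 3
      · exact v3 4
    · intro i
      fin_cases i
      · exact v4 0
      · exact v4 2
      · exact v4 1
      · exact v4 3
      · exact v4 4
end

section
/- Let A_0, A_1, A_2, A_3, A_4 be a commutative association scheme on a finite nonempty set X with A_1ᵀ = A_1, A_2ᵀ = A_2 and A_3ᵀ = A_4, with primitive idempotents E_0, ..., E_4, whose symmetrization (with matrices A_0, A_1, A_2, A_3 + A_4) is amorphic with primitive idempotents ordered Ẽ_0, Ẽ_1, Ẽ_2, Ẽ_3 so that the character table has the form (1.2). If Ẽ_3 equals one of E_1, E_2, E_3, E_4, then each of the matrices A_1 + A_3, A_2 + A_3 and A_3 has exactly 5 distinct eigenvalues. -/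
open Matrix Polynomial

structure Bas {X : Type*} [Fintype X] [DecidableEq X]
    (S F : Fin 4 → Matrix X X ℂ) (k a b : Fin 4 → ℂ) : Prop where
  zo : ∀ i, IsZeroOne (S i)
  S0 : S 0 = 1
  sum : (∑ i, S i) = Matrix.of (fun _ _ => (1:ℂ))
  sym : ∀ i, (S i)ᵀ = S i
  ne : ∀ i, S i ≠ 0
  PI : ArePrimIdem S F
  form : HasForm12 S F k a b

set_option linter.unusedSectionVars false

section
variable {X : Type*} [Fintype X] [DecidableEq X] [Nonempty X]
  {S F : Fin 4 → Matrix X X ℂ} {k a b : Fin 4 → ℂ}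

lemma Bas.disj (h : Bas S F k a b) (i j : Fin 4) (hij : i ≠ j) (x y : X) :
    S i x y * S j x y = 0 := by
  have hs := congrFun (congrFun h.sum x) y
  simp only [Matrix.sum_apply, Fin.sum_univ_four, Matrix.of_apply] at hs
  rcases h.zo 0 x y with h0 | h0 <;> rcases h.zo 1 x y with h1 | h1 <;>
  rcases h.zo 2 x y with h2 | h2 <;> rcases h.zo 3 x y with h3 | h3 <;>
  rw [h0, h1, h2, h3] at hs <;> norm_num at hs <;>
  (fin_cases i <;> fin_cases j <;> simp_all)

lemma Bas.tr (h : Bas S F k a b) (i j : Fin 4) (hij : i ≠ j) :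
    (S i * S j).trace = 0 := by
  rw [Matrix.trace]
  apply Finset.sum_eq_zero
  intro x _
  rw [Matrix.diag_apply, Matrix.mul_apply]
  apply Finset.sum_eq_zero
  intro y _
  have := h.disj i j hij x y
  rw [← h.sym j, Matrix.transpose_apply]
  exact this

lemma Bas.cardne : (Fintype.card X : ℂ) ≠ 0 := by
  simp [Fintype.card_ne_zero]

lemma Bas.trF0 (h : Bas S F k a b) : (F 0).trace = 1 := by
  rw [h.PI.2.1, Matrix.trace_smul, Matrix.trace]
  simp

lemma Bas.decomp (h : Bas S F k a b) (i : Fin 4) (hi : i ≠ 0) :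
    S i = a i • (1 : Matrix X X ℂ) + (k i - a i) • F 0 + (b i - a i) • F i := by
  obtain ⟨h0, h1, h2, -⟩ := h.form i hi
  have hs := h.PI.2.2.2.1
  rw [Fin.sum_univ_four] at hs
  have : S i = S i * (F 0 + F 1 + F 2 + F 3) := by rw [hs, mul_one]
  rw [this, ← hs]
  simp only [mul_add]
  fin_cases i
  · exact absurd rfl hi
  · simp only [Fin.mk_one, Fin.reduceFinMk] at *
    rw [h0, h1, h2 2 (by decide) (by decide), h2 3 (by decide) (by decide)]; module
  · simp only [Fin.mk_one, Fin.reduceFinMk] at *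
    rw [h0, h1, h2 1 (by decide) (by decide), h2 3 (by decide) (by decide)]; module
  · simp only [Fin.mk_one, Fin.reduceFinMk] at *
    rw [h0, h1, h2 1 (by decide) (by decide), h2 2 (by decide) (by decide)]; module

lemma Bas.tr1 (h : Bas S F k a b) (i : Fin 4) (hi : i ≠ 0) :
    k i + a i * (Fintype.card X - 1) + (b i - a i) * (F i).trace = 0 := by
  have h1 := h.tr i 0 hi
  rw [h.S0, mul_one, h.decomp i hi] at h1
  simp only [Matrix.trace_add, Matrix.trace_smul, Matrix.trace_one, h.trF0, smul_eq_mul] at h1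
  linear_combination h1

lemma Bas.key (h : Bas S F k a b) (i j : Fin 4) (hi : i ≠ 0) (hj : j ≠ 0) (hij : i ≠ j) :
    (k i - a i) * (k j - a j) = Fintype.card X * a i * a j := by
  have h1 := h.tr i j hij
  have ei := h.tr1 i hi
  have ej := h.tr1 j hj
  obtain ⟨p0, -, -, -⟩ := h.form i hi
  obtain ⟨-, p1, -, -⟩ := h.form i hi
  obtain ⟨-, -, p2, -⟩ := h.form i hi
  have q : S i * S j = a j • S i + (k j - a j) • (k i • F 0) + (b j - a j) • (a i • F j) := by
    conv_lhs => rw [h.decomp j hj]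
    rw [mul_add, mul_add, Matrix.mul_smul, Matrix.mul_smul, Matrix.mul_smul, mul_one, p0,
      p2 j hj hij.symm]
  have t := h.tr i 0 hi
  rw [h.S0, mul_one] at t
  rw [q] at h1
  simp only [Matrix.trace_add, Matrix.trace_smul, h.trF0, t, smul_eq_mul] at h1
  linear_combination h1 - a i * ej

lemma Bas.rowsum (h : Bas S F k a b) (i : Fin 4) (hi : i ≠ 0) (x : X) :
    ∑ y, S i x y = k i := by
  obtain ⟨p0, -, -, -⟩ := h.form i hi
  rw [h.PI.2.1, Matrix.mul_smul, smul_comm] at p0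
  have hc : ((Fintype.card X : ℂ))⁻¹ ≠ 0 := inv_ne_zero Bas.cardne
  have p1 := smul_right_injective _ hc p0
  have := congrFun (congrFun p1 x) x
  simpa [Matrix.mul_apply] using this

lemma zo_re {A : Matrix X X ℂ} (h : IsZeroOne A) (x y : X) :
    0 ≤ (A x y).re ∧ (A x y).im = 0 ∧ ‖A x y‖ = (A x y).re := by
  rcases h x y with h | h <;> simp [h]

lemma Bas.kreal (h : Bas S F k a b) (i : Fin 4) (hi : i ≠ 0) : k i = ((k i).re : ℂ) := by
  obtain ⟨x⟩ := (inferInstance : Nonempty X)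
  rw [← h.rowsum i hi x]
  apply Complex.ext
  · simp
  · simp only [Complex.im_sum, Complex.ofReal_im]
    exact Finset.sum_eq_zero fun y _ => (zo_re (h.zo i) x y).2.1

lemma Bas.kne (h : Bas S F k a b) (i : Fin 4) (hi : i ≠ 0) : k i ≠ 0 := by
  intro hk
  apply h.ne i
  ext x y
  have h1 := congrArg Complex.re (h.rowsum i hi x)
  rw [hk, Complex.re_sum, Complex.zero_re,
    Finset.sum_eq_zero_iff_of_nonneg (fun y _ => (zo_re (h.zo i) x y).1)] at h1
  have := h1 y (Finset.mem_univ _)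
  exact Complex.ext (by simpa using this) (by simpa using (zo_re (h.zo i) x y).2.1)

lemma Bas.kna (h : Bas S F k a b) (i : Fin 4) (hi : i ≠ 0) : k i ≠ a i := by
  intro hk
  have hc := Bas.cardne (X := X)
  have aux : ∀ j l : Fin 4, j ≠ 0 → l ≠ 0 → i ≠ j → i ≠ l → j ≠ l → False := by
    intro j l hj hl hij hil hjl
    have e1 := h.key i j hi hj hij
    have e2 := h.key i l hi hl hil
    have e3 := h.key j l hj hl hjl
    have ki := h.kne i hi
    rw [← hk, sub_self, zero_mul] at e1 e2
    have a1 : a j = 0 := by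
      rcases mul_eq_zero.1 e1.symm with h | h
      · exact absurd h (mul_ne_zero hc ki)
      · exact h
    have a2 : a l = 0 := by
      rcases mul_eq_zero.1 e2.symm with h | h
      · exact absurd h (mul_ne_zero hc ki)
      · exact h
    rw [a1, a2] at e3
    simp only [sub_zero, mul_zero] at e3
    exact mul_ne_zero (h.kne j hj) (h.kne l hl) e3
  fin_cases i
  · exact hi rfl
  · exact aux 2 3 (by decide) (by decide) (by decide) (by decide) (by decide)
  · exact aux 1 3 (by decide) (by decide) (by decide) (by decide) (by decide)
  · exact aux 1 2 (by decide) (by decide) (by decide) (by decide) (by decide)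

lemma Bas.Fne (h : Bas S F k a b) (i : Fin 4) (hi : i ≠ 0) : F i ≠ 0 := by
  intro hF
  have hc := Bas.cardne (X := X)
  have e := h.tr1 i hi
  rw [hF, Matrix.trace_zero, mul_zero, add_zero] at e
  have aux : ∀ j : Fin 4, j ≠ 0 → i ≠ j → False := by
    intro j hj hij
    have e1 := h.key i j hi hj hij
    have e2 : Fintype.card X * (a i * k j) = 0 := by
      linear_combination -e1 + (k j - a j) * e
    have e3 := (mul_eq_zero.1 e2).resolve_left hc
    have e4 := (mul_eq_zero.1 e3).resolve_right (h.kne j hj)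
    rw [e4] at e
    exact h.kne i hi (by simpa using e)
  fin_cases i
  · exact hi rfl
  · exact aux 2 (by decide) (by decide)
  · exact aux 1 (by decide) (by decide)
  · exact aux 1 (by decide) (by decide)

lemma Bas.F0ne (h : Bas S F k a b) : F 0 ≠ 0 := by
  intro h0
  have := h.trF0
  rw [h0] at this
  simp at this

open scoped ComplexOrder in
lemma tr_ne {G : Matrix X X ℂ} (hG : G ≠ 0) : (Gᴴ * G).trace ≠ 0 := by
  rwa [Ne, Matrix.trace_conjTranspose_mul_self_eq_zero_iff]

lemma conj_eig {M G : Matrix X X ℂ} {θ e : ℂ} (hM : Mᴴ = e • M) (hG : G ≠ 0)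
    (hMG : M * G = θ • G) : star θ = e * θ := by
  have h1 : (Gᴴ * M * G).trace = θ * (Gᴴ * G).trace := by
    rw [mul_assoc, hMG, Matrix.mul_smul, Matrix.trace_smul, smul_eq_mul]
  have h2 : (Gᴴ * M * G).trace * e = star θ * (Gᴴ * G).trace := by
    have : Gᴴ * Mᴴ = star θ • Gᴴ := by
      rw [← Matrix.conjTranspose_mul, hMG, Matrix.conjTranspose_smul]
    rw [hM, Matrix.mul_smul] at this
    have h3 := congrArg (fun Z => (Z * G).trace) this
    simp only [Matrix.smul_mul, Matrix.trace_smul, smul_eq_mul] at h3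
    linear_combination h3
  have h3 : (Gᴴ * G).trace ≠ 0 := tr_ne hG
  apply mul_right_cancel₀ h3
  rw [← h2, h1]; ring

lemma zo_conj {A : Matrix X X ℂ} (h : IsZeroOne A) : Aᴴ = Aᵀ := by
  ext x y
  rw [Matrix.conjTranspose_apply, Matrix.transpose_apply]
  rcases h y x with h | h <;> simp [h]

lemma Bas.eig (h : Bas S F k a b) (i : Fin 4) (hi : i ≠ 0) {G : Matrix X X ℂ} {θ : ℂ}
    (hG : G ≠ 0) (hS : S i * G = θ • G) : θ = (θ.re : ℂ) ∧ θ.re ≤ (k i).re := by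
  constructor
  · have h1 : (S i)ᴴ = (1:ℂ) • S i := by rw [zo_conj (h.zo i), h.sym, one_smul]
    have := conj_eig h1 hG hS
    rw [one_mul] at this
    exact (Complex.conj_eq_iff_re.1 this).symm
  · have : ∃ y, ∃ x, G x y ≠ 0 := by
      by_contra hc
      push Not at hc
      exact hG (by ext x y; exact hc y x)
    obtain ⟨y, x0, hx0⟩ := this
    obtain ⟨x, -, hx⟩ := Finset.exists_max_image Finset.univ (fun x => ‖G x y‖) ⟨x0, Finset.mem_univ _⟩
    have hpos : 0 < ‖G x y‖ := lt_of_lt_of_le (norm_pos_iff.2 hx0) (hx x0 (Finset.mem_univ _))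
    have e := congrFun (congrFun hS x) y
    rw [Matrix.mul_apply, Matrix.smul_apply, smul_eq_mul] at e
    have e2 : ‖θ‖ * ‖G x y‖ ≤ (k i).re * ‖G x y‖ := by
      rw [← norm_mul, ← e, ← h.rowsum i hi x, Complex.re_sum, Finset.sum_mul]
      refine (norm_sum_le _ _).trans (Finset.sum_le_sum fun z _ => ?_)
      rw [norm_mul, (zo_re (h.zo i) x z).2.2]
      exact mul_le_mul_of_nonneg_left (hx z (Finset.mem_univ _)) (zo_re (h.zo i) x z).1
    exact (Complex.re_le_norm θ).trans (le_of_mul_le_mul_right e2 hpos)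

lemma Bas.rs (h : Bas S F k a b) :
    (1 + a 1 + b 2 + a 3 = 0) ∧ (1 + a 1 + a 2 + b 3 = 0) := by
  have hJ : ∀ j, j ≠ 0 → (∑ i, S i) * F j = 0 := by
    intro j hj
    have h1 := h.PI.2.2.1 0 j
    rw [if_neg hj.symm, h.PI.2.1, Matrix.smul_mul] at h1
    rw [h.sum]
    exact (smul_eq_zero.1 h1).resolve_left (inv_ne_zero Bas.cardne)
  have f1 := h.form 1 (by decide)
  have f2 := h.form 2 (by decide)
  have f3 := h.form 3 (by decide)
  constructor
  · have := hJ 2 (by decide)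
    rw [Fin.sum_univ_four, add_mul, add_mul, add_mul, h.S0, one_mul, f1.2.2.1 2 (by decide) (by decide),
      f2.2.1, f3.2.2.1 2 (by decide) (by decide)] at this
    have e : (1 + a 1 + b 2 + a 3) • F 2 = 0 := by rw [← this]; module
    exact (smul_eq_zero.1 e).resolve_right (h.Fne 2 (by decide))
  · have := hJ 3 (by decide)
    rw [Fin.sum_univ_four, add_mul, add_mul, add_mul, h.S0, one_mul, f1.2.2.1 3 (by decide) (by decide),
      f2.2.2.1 3 (by decide) (by decide), f3.2.1] at this
    have e : (1 + a 1 + a 2 + b 3) • F 3 = 0 := by rw [← this]; module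
    exact (smul_eq_zero.1 e).resolve_right (h.Fne 3 (by decide))

lemma count_eig {m : ℕ} (B : Matrix X X ℂ) (G : Fin m → Matrix X X ℂ) (l : Fin m → ℂ)
    (hl : Function.Injective l) (hG : ∀ i, G i ≠ 0) (hs : ∑ i, G i = 1)
    (hBG : ∀ i, B * G i = l i • G i) (hc : ∀ i, G i * B = B * G i) :
    numDistinctEigen B = m := by
  classical
  have : B.charpoly.roots.toFinset = Finset.univ.image l := by
    ext t
    rw [Multiset.mem_toFinset, Polynomial.mem_roots (Matrix.charpoly_monic B).ne_zero,
      ← Matrix.mem_spectrum_iff_isRoot_charpoly, ← Matrix.spectrum_toLin',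
      ← Module.End.hasEigenvalue_iff_mem_spectrum]
    simp only [Finset.mem_image, Finset.mem_univ, true_and]
    constructor
    · intro ht
      obtain ⟨v, hv⟩ := ht.exists_hasEigenvector
      have hv1 : B *ᵥ v = t • v := by
        have := hv.apply_eq_smul
        rwa [Matrix.toLin'_apply] at this
      by_contra hcon
      push Not at hcon
      apply hv.2
      have : ∀ i, G i *ᵥ v = 0 := by
        intro i
        have e1 : (G i * B) *ᵥ v = t • (G i *ᵥ v) := by
          rw [← Matrix.mulVec_mulVec, hv1, Matrix.mulVec_smul]
        rw [hc, hBG, Matrix.smul_mulVec] at e1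
        have e2 : (l i - t) • (G i *ᵥ v) = 0 := by rw [sub_smul, e1, sub_self]
        exact (smul_eq_zero.1 e2).resolve_left (sub_ne_zero.2 (hcon i))
      rw [← Matrix.one_mulVec v, ← hs, Matrix.sum_mulVec]
      exact Finset.sum_eq_zero fun i _ => this i
    · rintro ⟨i, rfl⟩
      have : ∃ y, ∃ x, G i x y ≠ 0 := by
        by_contra hc
        push Not at hc
        exact hG i (by ext x y; exact hc y x)
      obtain ⟨y, x0, hx0⟩ := this
      apply Module.End.hasEigenvalue_of_hasEigenvector (x := fun x => G i x y)
      rw [Module.End.hasEigenvector_iff]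
      refine ⟨?_, fun h => hx0 (congrFun h x0)⟩
      rw [Module.End.mem_eigenspace_iff, Matrix.toLin'_apply]
      ext x
      have := congrFun (congrFun (hBG i) x) y
      rw [Matrix.mul_apply] at this
      simpa [Matrix.mulVec, dotProduct] using this
  rw [numDistinctEigen, this, Finset.card_image_of_injective _ hl, Finset.card_univ, Fintype.card_fin]

lemma count5 (B G0 P Q G2 G3 : Matrix X X ℂ) (r0 r1 r2 r3 : ℝ) (ν : ℂ) (hν : ν ≠ 0)
    (hν' : star ν = -ν) (h02 : r0 ≠ r2) (h03 : r0 ≠ r3) (h23 : r2 ≠ r3)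
    (n0 : G0 ≠ 0) (nP : P ≠ 0) (nQ : Q ≠ 0) (n2 : G2 ≠ 0) (n3 : G3 ≠ 0)
    (hs : G0 + P + Q + G2 + G3 = 1)
    (e0 : B * G0 = (r0:ℂ) • G0) (eP : B * P = ((r1:ℂ) + ν / 2) • P)
    (eQ : B * Q = ((r1:ℂ) - ν / 2) • Q)
    (e2 : B * G2 = (r2:ℂ) • G2) (e3 : B * G3 = (r3:ℂ) • G3)
    (c0 : G0 * B = B * G0) (cP : P * B = B * P) (cQ : Q * B = B * Q)
    (c2 : G2 * B = B * G2) (c3 : G3 * B = B * G3) : numDistinctEigen B = 5 := by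
  have hre : ν.re = 0 := by
    have := congrArg Complex.re hν'
    simp at this; linarith
  have him : ν.im ≠ 0 := fun h => hν (Complex.ext hre h)
  have hP : ∀ r : ℝ, (r1:ℂ) + ν / 2 ≠ r := by
    intro r h
    have := congrArg Complex.im h
    simp at this; exact him this
  have hQ : ∀ r : ℝ, (r1:ℂ) - ν / 2 ≠ r := by
    intro r h
    have := congrArg Complex.im h
    simp at this; exact him this
  have hPQ : (r1:ℂ) + ν / 2 ≠ (r1:ℂ) - ν / 2 := by
    intro h; apply hν; linear_combination h
  have g02 : (r0:ℂ) ≠ r2 := by exact_mod_cast h02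
  have g03 : (r0:ℂ) ≠ r3 := by exact_mod_cast h03
  have g23 : (r2:ℂ) ≠ r3 := by exact_mod_cast h23
  apply count_eig B ![G0, P, Q, G2, G3] ![(r0:ℂ), (r1:ℂ) + ν / 2, (r1:ℂ) - ν / 2, r2, r3]
  · intro i j hij
    by_contra hne
    fin_cases i <;> fin_cases j <;> first
      | exact hne rfl
      | exact hP _ hij
      | exact hQ _ hij
      | exact hP _ hij.symm
      | exact hQ _ hij.symm
      | exact hPQ hij
      | exact hPQ hij.symm
      | exact g02 hij
      | exact g02 hij.symm
      | exact g03 hij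
      | exact g03 hij.symm
      | exact g23 hij
      | exact g23 hij.symm
  · intro i; fin_cases i <;> assumption
  · simpa [Fin.sum_univ_five] using hs
  · intro i; fin_cases i <;> assumption
  · intro i; fin_cases i <;> assumption

lemma zo_diff {A : Matrix X X ℂ} (h : IsZeroOne A) (h' : IsZeroOne (A + Aᵀ)) (x y : X) :
    (A + Aᵀ) x y = 0 → (A - Aᵀ) x y = 0 := by
  simp only [Matrix.add_apply, Matrix.sub_apply, Matrix.transpose_apply]
  rcases h x y with h1 | h1 <;> rcases h y x with h2 | h2 <;> simp [h1, h2]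

lemma Bas.core (h : Bas S F k a b) (A : Matrix X X ℂ) (zA : IsZeroOne A)
    (hS3 : S 3 = A + Aᵀ) (cF : ∀ i, F i * A = A * F i) (cS : ∀ i j, F i * S j = S j * F i)
    (tF : (F 1)ᵀ = F 1) (hN : A - Aᵀ ≠ 0)
    (N0 : (A - Aᵀ) * F 0 = 0) (N2 : (A - Aᵀ) * F 2 = 0) (N3 : (A - Aᵀ) * F 3 = 0)
    (c : Fin 4 → ℂ) (hNN : (A - Aᵀ) * (A - Aᵀ) = ∑ i, c i • S i) :
    numDistinctEigen (S 1 + A) = 5 ∧ numDistinctEigen (S 2 + A) = 5 ∧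
      numDistinctEigen A = 5 := by
  set N := A - Aᵀ with hNdef
  have hA : A = (2:ℂ)⁻¹ • (S 3 + N) := by
    rw [hS3, hNdef]; module
  have tN : Nᵀ = -N := by
    rw [hNdef, Matrix.transpose_sub, Matrix.transpose_transpose]; abel
  have cN : ∀ i, F i * N = N * F i := by
    intro i
    have : N = (2:ℂ) • A - S 3 := by rw [hS3, hNdef]; module
    rw [this, mul_sub, sub_mul, Matrix.mul_smul, Matrix.smul_mul, cF, cS]
  have hNc : Nᴴ = (-1:ℂ) • N := by
    rw [hNdef, Matrix.conjTranspose_sub, zo_conj zA]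
    have : (Aᵀ)ᴴ = A := by rw [← zo_conj zA, Matrix.conjTranspose_conjTranspose]
    rw [this]; module
  have sF := h.PI.2.2.2.1
  rw [Fin.sum_univ_four] at sF
  have idem := h.PI.2.2.1
  have N1 : N * F 1 = N := by
    have : N * (F 0 + F 1 + F 2 + F 3) = N := by rw [sF, mul_one]
    rwa [mul_add, mul_add, mul_add, N0, N2, N3, zero_add, add_zero, add_zero] at this
  have f1 := h.form 1 (by decide)
  have f2 := h.form 2 (by decide)
  have f3 := h.form 3 (by decide)
  have f1' := f1.2.2.1
  have f2' := f2.2.2.1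
  have f3' := f3.2.2.1
  -- N squared
  have hNN0 : N * N ≠ 0 := by
    intro h0
    have : Nᴴ * N = 0 := by rw [hNc, Matrix.smul_mul, h0, smul_zero]
    exact tr_ne hN (by rw [this, Matrix.trace_zero])
  have hmu : ∃ μ : ℂ, N * N = μ • F 1 := by
    refine ⟨c 0 + c 1 * b 1 + c 2 * a 2 + c 3 * a 3, ?_⟩
    have : N * N = (N * N) * F 1 := by rw [mul_assoc, N1]
    rw [this, hNN, Fin.sum_univ_four, add_mul, add_mul, add_mul]
    simp only [Matrix.smul_mul]
    rw [h.S0, one_mul, f1.2.1, f2' 1 (by decide) (by decide), f3' 1 (by decide) (by decide)]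
    module
  obtain ⟨μ, hμ⟩ := hmu
  have hμ0 : μ ≠ 0 := by rintro rfl; exact hNN0 (by rw [hμ, zero_smul])
  obtain ⟨ν, hν⟩ := IsAlgClosed.exists_pow_nat_eq μ (n := 2) (by norm_num)
  have hν0 : ν ≠ 0 := by rintro rfl; apply hμ0; rw [← hν]; norm_num
  set P := (2:ℂ)⁻¹ • (F 1 + ν⁻¹ • N) with hPdef
  set Q := (2:ℂ)⁻¹ • (F 1 - ν⁻¹ • N) with hQdef
  have PQ : P + Q = F 1 := by rw [hPdef, hQdef]; module
  have tP : Pᵀ = Q := by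
    rw [hPdef, hQdef, Matrix.transpose_smul, Matrix.transpose_add, Matrix.transpose_smul, tN, tF]
    module
  have F1ne := h.Fne 1 (by decide)
  have nP : P ≠ 0 := by
    intro h0; apply F1ne; rw [← PQ, ← tP, h0]; simp
  have nQ : Q ≠ 0 := by
    intro h0; apply nP; rw [← Matrix.transpose_transpose P, tP, h0]; simp
  have NP : N * P = ν • P := by
    rw [hPdef, Matrix.mul_smul, mul_add, Matrix.mul_smul, N1, hμ, ← hν]
    match_scalars <;> field_simp
  have NQ : N * Q = (-ν) • Q := by
    rw [hQdef, Matrix.mul_smul, mul_sub, Matrix.mul_smul, N1, hμ, ← hν]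
    match_scalars <;> field_simp
  have hνs : star ν = -ν := by
    have := conj_eig hNc nP NP
    rw [this]; ring
  have F1N : F 1 * N = N := by rw [cN, N1]
  have F11 : F 1 * F 1 = F 1 := by simpa using idem 1 1
  have FP : F 1 * P = P := by
    rw [hPdef, Matrix.mul_smul, mul_add, Matrix.mul_smul, F1N, F11]
  have FQ : F 1 * Q = Q := by
    rw [hQdef, Matrix.mul_smul, mul_sub, Matrix.mul_smul, F1N, F11]
  have onPQ : ∀ (M : Matrix X X ℂ) (t : ℂ), M * F 1 = t • F 1 → M * P = t • P ∧ M * Q = t • Q := by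
    intro M t hM
    constructor
    · rw [← FP, ← mul_assoc, hM, Matrix.smul_mul]
    · rw [← FQ, ← mul_assoc, hM, Matrix.smul_mul]
  -- realness
  have F2ne := h.Fne 2 (by decide)
  have F3ne := h.Fne 3 (by decide)
  have F0ne := h.F0ne
  have ra1 := h.eig 1 (by decide) F2ne (f1' 2 (by decide) (by decide))
  have rb1 := h.eig 1 (by decide) F1ne f1.2.1
  have ra2 := h.eig 2 (by decide) F1ne (f2' 1 (by decide) (by decide))
  have rb2 := h.eig 2 (by decide) F2ne f2.2.1
  have ra3 := h.eig 3 (by decide) F1ne (f3' 1 (by decide) (by decide))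
  have rb3 := h.eig 3 (by decide) F3ne f3.2.1
  have rk1 := h.kreal 1 (by decide)
  have rk2 := h.kreal 2 (by decide)
  have rk3 := h.kreal 3 (by decide)
  have lt : ∀ i, i ≠ 0 → a i = ((a i).re : ℂ) → (a i).re ≤ (k i).re → (a i).re < (k i).re := by
    intro i hi h1 h2
    refine lt_of_le_of_ne h2 fun h3 => h.kna i hi ?_
    rw [h.kreal i hi, h1, h3]
  have l1 := lt 1 (by decide) ra1.1 ra1.2
  have l2 := lt 2 (by decide) ra2.1 ra2.2
  have l3 := lt 3 (by decide) ra3.1 ra3.2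
  have ab3 : (a 3).re ≠ (b 3).re := by
    intro h3; apply f3.2.2.2; rw [ra3.1, rb3.1, h3]
  have rs := h.rs
  have rs' : (b 2).re - (a 2).re = (b 3).re - (a 3).re := by
    have : b 2 - a 2 = b 3 - a 3 := by linear_combination rs.1 - rs.2
    simpa using congrArg Complex.re this
  -- k3 ≠ b3
  have kb3 : k 3 ≠ b 3 := by
    intro hkb
    have hsq : S 3 * S 3 = (k 3 + a 3) • S 3 - (k 3 * a 3) • (1 : Matrix X X ℂ) := by
      have : S 3 * S 3 = S 3 * S 3 * (F 0 + F 1 + F 2 + F 3) := by rw [sF, mul_one]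
      rw [this, mul_assoc]
      have e3 : S 3 * (F 0 + F 1 + F 2 + F 3) = k 3 • F 0 + a 3 • F 1 + a 3 • F 2 + k 3 • F 3 := by
        simp only [mul_add]
        rw [f3.1, f3.2.1, f3' 1 (by decide) (by decide), f3' 2 (by decide) (by decide), hkb]
      have e3' : S 3 = k 3 • F 0 + a 3 • F 1 + a 3 • F 2 + k 3 • F 3 := by rw [← e3, sF, mul_one]
      rw [e3]
      simp only [mul_add, Matrix.mul_smul]
      rw [f3.1, f3.2.1, f3' 1 (by decide) (by decide), f3' 2 (by decide) (by decide), ← hkb]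
      rw [← sF]
      nth_rewrite 1 [e3']
      module
    have supp : ∀ x y, x ≠ y → S 3 x y = 0 → (N * N) x y = 0 := by
      intro x y hxy hxy3
      have e := congrFun (congrFun hsq x) y
      simp only [Matrix.sub_apply, Matrix.smul_apply, hxy3, Matrix.one_apply_ne hxy, smul_zero,
        sub_zero, Matrix.mul_apply] at e
      have e' := congrArg Complex.re e
      rw [Complex.re_sum, Complex.zero_re, Finset.sum_eq_zero_iff_of_nonneg] at e'
      · rw [Matrix.mul_apply]
        apply Finset.sum_eq_zero
        intro z _
        have e2 := e' z (Finset.mem_univ _)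
        rcases h.zo 3 x z with q | q
        · rw [hS3] at q
          rw [hNdef, zo_diff zA (hS3 ▸ h.zo 3) x z q, zero_mul]
        · rcases h.zo 3 z y with q' | q'
          · rw [hS3] at q'
            rw [hNdef, zo_diff zA (hS3 ▸ h.zo 3) z y q', mul_zero]
          · rw [q, q'] at e2; simp at e2
      · intro z _
        rcases h.zo 3 x z with q | q <;> rcases h.zo 3 z y with q' | q' <;> simp [q, q']
    have cz : ∀ i : Fin 4, i ≠ 0 → i ≠ 3 → c i = 0 := by
      intro i hi hi3
      have : ∃ x y, S i x y ≠ 0 := by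
        by_contra hc
        push Not at hc
        exact h.ne i (by ext x y; exact hc x y)
      obtain ⟨x, y, hxy⟩ := this
      have z : ∀ j, i ≠ j → S j x y = 0 := fun j hj =>
        (mul_eq_zero.1 (h.disj i j hj x y)).resolve_left hxy
      have hne : x ≠ y := by
        rintro rfl
        have := z 0 hi
        rw [h.S0] at this
        simp at this
      have e := supp x y hne (z 3 hi3)
      rw [hNN, Matrix.sum_apply, Finset.sum_eq_single i] at e
      · rw [Matrix.smul_apply, smul_eq_mul] at e
        exact (mul_eq_zero.1 e).resolve_right hxy
      · intro j _ hj
        rw [Matrix.smul_apply, z j hj.symm, smul_zero]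
      · simp
    rw [Fin.sum_univ_four, cz 1 (by decide) (by decide), cz 2 (by decide) (by decide), h.S0] at hNN
    simp only [zero_smul, add_zero] at hNN
    have g2 : (c 0 + c 3 * a 3) • F 2 = 0 := by
      have : N * N * F 2 = 0 := by rw [mul_assoc, N2, mul_zero]
      rw [hNN, add_mul, Matrix.smul_mul, Matrix.smul_mul, one_mul,
        f3' 2 (by decide) (by decide)] at this
      rw [← this]; module
    have g := (smul_eq_zero.1 g2).resolve_right F2ne
    have g1 : N * N * F 1 = 0 := by
      rw [hNN, add_mul, Matrix.smul_mul, Matrix.smul_mul, one_mul,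
        f3' 1 (by decide) (by decide), smul_smul, ← add_smul, g, zero_smul]
    rw [mul_assoc, N1] at g1
    exact hNN0 g1
  have kb3' : (k 3).re ≠ (b 3).re := by
    intro h3; apply kb3; rw [rk3, rb3.1, h3]
  have sFF : F 0 + P + Q + F 2 + F 3 = 1 := by rw [← sF, ← PQ]; abel
  have cPQ : ∀ M : Matrix X X ℂ, F 1 * M = M * F 1 → N * M = M * N →
      P * M = M * P ∧ Q * M = M * Q := by
    intro M h1 h2
    constructor
    · rw [hPdef, Matrix.smul_mul, Matrix.mul_smul, add_mul, mul_add, Matrix.smul_mul,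
        Matrix.mul_smul, h1, h2]
    · rw [hQdef, Matrix.smul_mul, Matrix.mul_smul, sub_mul, mul_sub, Matrix.smul_mul,
        Matrix.mul_smul, h1, h2]
  have PA := onPQ _ _ (f3' 1 (by decide) (by decide))
  have P1 := onPQ _ _ f1.2.1
  have P2 := onPQ _ _ (f2' 1 (by decide) (by decide))
  -- A acts
  have AF : ∀ (G : Matrix X X ℂ) (s t : ℂ), S 3 * G = s • G → N * G = t • G →
      A * G = (s / 2 + t / 2) • G := by
    intro G s t h1 h2
    rw [hA, Matrix.smul_mul, add_mul, h1, h2]; module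
  have A0 := AF (F 0) _ 0 f3.1 (by rw [N0, zero_smul])
  have A2 := AF (F 2) _ 0 (f3' 2 (by decide) (by decide)) (by rw [N2, zero_smul])
  have A3 := AF (F 3) _ 0 f3.2.1 (by rw [N3, zero_smul])
  have AP := AF P _ _ PA.1 NP
  have AQ := AF Q _ _ PA.2 NQ
  have SP : ∀ j, P * S j = S j * P ∧ Q * S j = S j * Q := by
    intro j
    have key : N * S j = S j * N := by
      have hdec : ∀ j, S j * F 1 = F 1 * S j := fun j => (cS 1 j).symm
      obtain ⟨p, hp⟩ := h.PI.2.2.2.2 j 1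
      have e1 : S j * N = p • N := by
        rw [← F1N, ← mul_assoc, hp, Matrix.smul_mul]
      have e2 : N * S j = p • N := by
        rw [← N1, mul_assoc, cS, hp, Matrix.mul_smul]
      rw [e1, e2]
    exact cPQ _ (cS 1 j) key
  have PA' : P * A = A * P ∧ Q * A = A * Q := by
    refine cPQ _ (cF 1) ?_
    have e1 : S 3 * N = a 3 • N := by
      rw [← F1N, ← mul_assoc, f3' 1 (by decide) (by decide), Matrix.smul_mul]
    have e2 : N * S 3 = a 3 • N := by
      rw [← N1, mul_assoc, cS, f3' 1 (by decide) (by decide), Matrix.mul_smul]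
    rw [hA, Matrix.smul_mul, Matrix.mul_smul, add_mul, mul_add, e1, e2]
  have addeig : ∀ (M G : Matrix X X ℂ) (s t u : ℂ), M * G = s • G → A * G = t • G → s + t = u →
      (M + A) * G = u • G := by
    intro M G s t u h1 h2 h3
    rw [add_mul, h1, h2, ← h3, add_smul]
  have addcom : ∀ (M G : Matrix X X ℂ), G * M = M * G → G * A = A * G →
      G * (M + A) = (M + A) * G := by
    intro M G h1 h2
    rw [add_mul, mul_add, h1, h2]
  refine ⟨?_, ?_, ?_⟩
  · apply count5 (S 1 + A) (F 0) P Q (F 2) (F 3) ((k 1).re + (k 3).re / 2) ((b 1).re + (a 3).re / 2)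
      ((a 1).re + (a 3).re / 2) ((a 1).re + (b 3).re / 2) ν hν0 hνs ?_ ?_ ?_ F0ne nP nQ F2ne F3ne sFF
    · exact addeig _ _ _ _ _ f1.1 A0 (by push_cast; rw [← rk1, ← rk3]; ring)
    · exact addeig _ _ _ _ _ P1.1 AP (by push_cast; rw [← rb1.1, ← ra3.1]; ring)
    · exact addeig _ _ _ _ _ P1.2 AQ (by push_cast; rw [← rb1.1, ← ra3.1]; ring)
    · exact addeig _ _ _ _ _ (f1' 2 (by decide) (by decide)) A2
        (by push_cast; rw [← ra1.1, ← ra3.1]; ring)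
    · exact addeig _ _ _ _ _ (f1' 3 (by decide) (by decide)) A3
        (by push_cast; rw [← ra1.1, ← rb3.1]; ring)
    · exact addcom _ _ (cS _ _) (cF _)
    · exact addcom _ _ (SP _).1 PA'.1
    · exact addcom _ _ (SP _).2 PA'.2
    · exact addcom _ _ (cS _ _) (cF _)
    · exact addcom _ _ (cS _ _) (cF _)
    · linarith
    · have := rb3.2; intro h; linarith
    · intro h; apply ab3; linarith
  · apply count5 (S 2 + A) (F 0) P Q (F 2) (F 3) ((k 2).re + (k 3).re / 2) ((a 2).re + (a 3).re / 2)
      ((b 2).re + (a 3).re / 2) ((a 2).re + (b 3).re / 2) ν hν0 hνs ?_ ?_ ?_ F0ne nP nQ F2ne F3ne sFF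
    · exact addeig _ _ _ _ _ f2.1 A0 (by push_cast; rw [← rk2, ← rk3]; ring)
    · exact addeig _ _ _ _ _ P2.1 AP (by push_cast; rw [← ra2.1, ← ra3.1]; ring)
    · exact addeig _ _ _ _ _ P2.2 AQ (by push_cast; rw [← ra2.1, ← ra3.1]; ring)
    · exact addeig _ _ _ _ _ f2.2.1 A2
        (by push_cast; rw [← rb2.1, ← ra3.1]; ring)
    · exact addeig _ _ _ _ _ (f2' 3 (by decide) (by decide)) A3
        (by push_cast; rw [← ra2.1, ← rb3.1]; ring)
    · exact addcom _ _ (cS _ _) (cF _)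
    · exact addcom _ _ (SP _).1 PA'.1
    · exact addcom _ _ (SP _).2 PA'.2
    · exact addcom _ _ (cS _ _) (cF _)
    · exact addcom _ _ (cS _ _) (cF _)
    · have := rb2.2; intro h; linarith
    · have := rb3.2; intro h; linarith
    · intro h; apply ab3; linarith
  · apply count5 A (F 0) P Q (F 2) (F 3) ((k 3).re / 2) ((a 3).re / 2)
      ((a 3).re / 2) ((b 3).re / 2) ν hν0 hνs ?_ ?_ ?_ F0ne nP nQ F2ne F3ne sFF
    · rw [A0]; congr 1; push_cast; rw [← rk3]; ring
    · rw [AP]; congr 1; push_cast; rw [← ra3.1]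
    · rw [AQ]; congr 1; push_cast; rw [← ra3.1]; ring
    · rw [A2]; congr 1; push_cast; rw [← ra3.1]; ring
    · rw [A3]; congr 1; push_cast; rw [← rb3.1]; ring
    · exact cF _
    · exact PA'.1
    · exact PA'.2
    · exact cF _
    · exact cF _
    · intro h; linarith
    · intro h; apply kb3'; linarith
    · intro h; apply ab3; linarith

lemma Bas.swap (h : Bas S F k a b) (σ : Equiv.Perm (Fin 4)) (hσ : σ 0 = 0) :
    Bas (S ∘ σ) (F ∘ σ) (k ∘ σ) (a ∘ σ) (b ∘ σ) where
  zo i := h.zo _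
  S0 := by simp [hσ, h.S0]
  sum := by rw [← h.sum]; exact Equiv.sum_comp σ S
  sym i := h.sym _
  ne i := h.ne _
  PI := by
    obtain ⟨p1, p2, p3, p4, p5⟩ := h.PI
    refine ⟨fun i => ?_, by simp [hσ, p2], fun i j => ?_, ?_, fun i j => p5 _ _⟩
    · rw [σ.surjective.range_comp]; exact p1 _
    · simp [p3]
    · rw [← p4]; exact Equiv.sum_comp σ F
  form := by
    intro i hi
    have hn : ∀ j, j ≠ 0 → σ j ≠ 0 := fun j hj h0 => hj (σ.injective (h0.trans hσ.symm))
    obtain ⟨q1, q2, q3, q4⟩ := h.form (σ i) (hn i hi)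
    refine ⟨by simpa [hσ] using q1, q2, fun j hj hji => q3 _ (hn j hj) ?_, q4⟩
    exact fun h => hji (σ.injective h)

end

theorem stmt11 {X : Type*} [Fintype X] [DecidableEq X] [Nonempty X]
    (A E : Fin 5 → Matrix X X ℂ) (Et : Fin 4 → Matrix X X ℂ) (k a b : Fin 4 → ℂ)
    (hA : IsAssocScheme A)
    (h1 : (A 1)ᵀ = A 1) (h2 : (A 2)ᵀ = A 2) (h34 : (A 3)ᵀ = A 4)
    (hE : ArePrimIdem A E)
    (hEt : ArePrimIdem (symmetrization (d := 3) A) Et)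
    (hAm : IsAmorphic (symmetrization (d := 3) A))
    (hP : HasForm12 (symmetrization (d := 3) A) Et k a b)
    (hin : ∃ j : Fin 5, j ≠ 0 ∧ Et 3 = E j) :
    numDistinctEigen (A 1 + A 3) = 5 ∧ numDistinctEigen (A 2 + A 3) = 5 ∧
    numDistinctEigen (A 3) = 5 := by
  obtain ⟨Ane, Azo, A0, Asum, -, Acom, Amul⟩ := hA
  set S := symmetrization (d := 3) A with hS
  have S0 : S 0 = A 0 := rfl
  have S1 : S 1 = A 1 := rfl
  have S2 : S 2 = A 2 := rfl
  have S3 : S 3 = A 3 + A 4 := rfl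
  have h43 : (A 4)ᵀ = A 3 := by rw [← h34, Matrix.transpose_transpose]
  have Asum' : ∀ x y, A 0 x y + A 1 x y + A 2 x y + A 3 x y + A 4 x y = 1 := by
    intro x y
    have := congrFun (congrFun Asum x) y
    simpa [Matrix.sum_apply, Fin.sum_univ_five] using this
  have zo3 : ∀ x y, (A 3 x y + A 4 x y = 0 ∨ A 3 x y + A 4 x y = 1) ∧ A 3 x y * A 4 x y = 0 := by
    intro x y
    have hs := Asum' x y
    rcases Azo 0 x y with h0 | h0 <;> rcases Azo 1 x y with h1 | h1 <;>
    rcases Azo 2 x y with h2 | h2 <;> rcases Azo 3 x y with h3 | h3 <;>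
    rcases Azo 4 x y with h4 | h4 <;>
    rw [h0, h1, h2, h3, h4] at hs <;> norm_num at hs <;> simp [h3, h4]
  have exne : ∃ x y, A 3 x y = 1 ∧ A 4 x y = 0 := by
    have : ∃ x y, A 3 x y ≠ 0 := by
      by_contra hc
      push Not at hc
      exact Ane 3 (by ext x y; exact hc x y)
    obtain ⟨x, y, hxy⟩ := this
    exact ⟨x, y, (Azo 3 x y).resolve_left hxy, (mul_eq_zero.1 (zo3 x y).2).resolve_left hxy⟩
  obtain ⟨x0, y0, hx3, hx4⟩ := exne
  have Ssym : ∀ i, (S i)ᵀ = S i := by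
    intro i
    fin_cases i
    · change (A 0)ᵀ = A 0
      rw [A0, Matrix.transpose_one]
    · exact h1
    · exact h2
    · change (A 3 + A 4)ᵀ = A 3 + A 4
      rw [Matrix.transpose_add, h34, h43, add_comm]
  have B : Bas S Et k a b := by
    refine ⟨?_, S0.trans A0, ?_, Ssym, ?_, hEt, hP⟩
    · intro i
      fin_cases i
      · exact Azo 0
      · exact Azo 1
      · exact Azo 2
      · exact fun x y => (zo3 x y).1
    · rw [← Asum, Fin.sum_univ_four, Fin.sum_univ_five, S0, S1, S2, S3, add_assoc _ (A 3)]
    · intro i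
      fin_cases i
      · exact Ane 0
      · exact Ane 1
      · exact Ane 2
      · intro h0
        have := congrFun (congrFun h0 x0) y0
        change A 3 x0 y0 + A 4 x0 y0 = 0 at this
        rw [hx3, hx4] at this
        norm_num at this
  set N := A 3 - A 4 with hNdef
  have Nne : N ≠ 0 := by
    intro h0
    have := congrFun (congrFun h0 x0) y0
    change A 3 x0 y0 - A 4 x0 y0 = 0 at this
    rw [hx3, hx4] at this
    norm_num at this
  have tN : Nᵀ = -N := by
    rw [hNdef, Matrix.transpose_sub, h34, h43]; abel
  -- algebra
  let M := Submodule.span ℂ (Set.range A)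
  have Amem : ∀ i, A i ∈ M := fun i => Submodule.subset_span ⟨i, rfl⟩
  have Mmul : ∀ C ∈ M, ∀ D ∈ M, C * D ∈ M := by
    intro C hC D hD
    obtain ⟨f, rfl⟩ := (Submodule.mem_span_range_iff_exists_fun ℂ).1 hC
    obtain ⟨g, rfl⟩ := (Submodule.mem_span_range_iff_exists_fun ℂ).1 hD
    rw [Finset.sum_mul]
    refine Submodule.sum_mem _ fun i _ => ?_
    rw [Finset.mul_sum]
    refine Submodule.sum_mem _ fun j _ => ?_
    rw [Matrix.smul_mul, Matrix.mul_smul]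
    refine Submodule.smul_mem _ _ (Submodule.smul_mem _ _ ?_)
    obtain ⟨p, hp⟩ := Amul i j
    rw [hp]
    exact Submodule.sum_mem _ fun l _ => Submodule.smul_mem _ _ (Amem l)
  have Mcom : ∀ C ∈ M, ∀ D ∈ M, C * D = D * C := by
    intro C hC D hD
    obtain ⟨f, rfl⟩ := (Submodule.mem_span_range_iff_exists_fun ℂ).1 hC
    obtain ⟨g, rfl⟩ := (Submodule.mem_span_range_iff_exists_fun ℂ).1 hD
    rw [Finset.sum_mul_sum, Finset.sum_mul_sum, Finset.sum_comm]
    refine Finset.sum_congr rfl fun i _ => Finset.sum_congr rfl fun j _ => ?_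
    rw [Matrix.smul_mul, Matrix.mul_smul, Matrix.smul_mul, Matrix.mul_smul, Acom, smul_comm]
  have Smem : ∀ i, S i ∈ M := by
    intro i
    fin_cases i
    · exact Amem 0
    · exact Amem 1
    · exact Amem 2
    · exact Submodule.add_mem _ (Amem 3) (Amem 4)
  have Fmem : ∀ i, Et i ∈ M := by
    intro i
    refine (Submodule.span_le.2 ?_) (hEt.1 i)
    rintro _ ⟨j, rfl⟩
    exact Smem j
  have Nmem : N ∈ M := Submodule.sub_mem _ (Amem 3) (Amem 4)
  have Fsym : ∀ i, (Et i)ᵀ = Et i := by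
    intro i
    obtain ⟨f, hf⟩ := (Submodule.mem_span_range_iff_exists_fun ℂ).1 (hEt.1 i)
    rw [← hf, Matrix.transpose_sum]
    refine Finset.sum_congr rfl fun j _ => ?_
    rw [Matrix.transpose_smul, Ssym]
  have tA0 : (A 0)ᵀ = A 0 := by rw [A0, Matrix.transpose_one]
  have anti : ∀ C ∈ M, Cᵀ = -C → ∃ t : ℂ, C = t • N := by
    intro C hC ht
    obtain ⟨f, hf⟩ := (Submodule.mem_span_range_iff_exists_fun ℂ).1 hC
    refine ⟨(f 3 - f 4) / 2, ?_⟩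
    have e : C = (2:ℂ)⁻¹ • (C - Cᵀ) := by rw [ht]; module
    rw [e, ← hf, Fin.sum_univ_five]
    simp only [Matrix.transpose_add, Matrix.transpose_smul, tA0, h1, h2, h34, h43, hNdef]
    module
  have symm' : ∀ C ∈ M, Cᵀ = C → ∃ c : Fin 4 → ℂ, C = ∑ i, c i • S i := by
    intro C hC ht
    obtain ⟨f, hf⟩ := (Submodule.mem_span_range_iff_exists_fun ℂ).1 hC
    refine ⟨![f 0, f 1, f 2, (f 3 + f 4) / 2], ?_⟩
    have e : C = (2:ℂ)⁻¹ • (C + Cᵀ) := by rw [ht]; module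
    rw [e, ← hf, Fin.sum_univ_five, Fin.sum_univ_four, S0, S1, S2, S3]
    simp only [Matrix.transpose_add, Matrix.transpose_smul, tA0, h1, h2, h34, h43]
    simp
    module
  have tNF : ∀ i, (N * Et i)ᵀ = -(N * Et i) := by
    intro i
    rw [Matrix.transpose_mul, tN, Fsym, mul_neg, Mcom _ (Fmem i) _ Nmem]
  have Nz : ∀ i (p : ℂ), N * Et i = p • Et i → N * Et i = 0 := by
    intro i p hp
    have := tNF i
    rw [hp, Matrix.transpose_smul, Fsym] at this
    rw [hp]
    have e : (2:ℂ) • (p • Et i) = 0 := by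
      rw [two_smul]; nth_rewrite 1 [this]; simp
    exact (smul_eq_zero.1 e).resolve_left two_ne_zero
  have Neig : ∀ j, ∃ p : ℂ, N * E j = p • E j := by
    intro j
    obtain ⟨p, hp⟩ := hE.2.2.2.2 3 j
    obtain ⟨q, hq⟩ := hE.2.2.2.2 4 j
    exact ⟨p - q, by rw [hNdef, sub_mul, hp, hq, sub_smul]⟩
  have N0 : N * Et 0 = 0 := by
    obtain ⟨p, hp⟩ := Neig 0
    have : E 0 = Et 0 := by rw [hE.2.1, hEt.2.1]
    rw [this] at hp
    exact Nz 0 p hp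
  have N3 : N * Et 3 = 0 := by
    obtain ⟨j, -, hj⟩ := hin
    obtain ⟨p, hp⟩ := Neig j
    rw [← hj] at hp
    exact Nz 3 p hp
  obtain ⟨c, hc⟩ := symm' (N * N) (Mmul _ Nmem _ Nmem) (by
    rw [Matrix.transpose_mul, tN, neg_mul_neg])
  obtain ⟨s, hs⟩ := anti (N * Et 1) (Mmul _ Nmem _ (Fmem 1)) (tNF 1)
  obtain ⟨t, ht⟩ := anti (N * Et 2) (Mmul _ Nmem _ (Fmem 2)) (tNF 2)
  have hst : s * t = 0 := by
    have e : N * Et 1 * Et 2 = 0 := by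
      rw [mul_assoc, hEt.2.2.1 1 2, if_neg (by decide), mul_zero]
    rw [hs, Matrix.smul_mul, ht, smul_smul] at e
    exact (smul_eq_zero.1 e).resolve_right Nne
  rcases mul_eq_zero.1 hst with h0 | h0
  · -- N * Et 1 = 0, swap
    rw [h0, zero_smul] at hs
    have B' := B.swap (Equiv.swap 1 2) (by decide)
    have e0 : (Equiv.swap (1 : Fin 4) 2) 0 = 0 := by decide
    have e1 : (Equiv.swap (1 : Fin 4) 2) 1 = 2 := by decide
    have e2 : (Equiv.swap (1 : Fin 4) 2) 2 = 1 := by decide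
    have e3 : (Equiv.swap (1 : Fin 4) 2) 3 = 3 := by decide
    have r := B'.core (A 3) (Azo 3) (by simp only [Function.comp, e3, h34, S3])
      (fun i => Mcom _ (Fmem _) _ (Amem 3)) (fun i j => Mcom _ (Fmem _) _ (Smem _)) (Fsym _)
      (by rw [h34]; exact Nne) (by simp only [Function.comp, e0, h34]; exact N0)
      (by simp only [Function.comp, e2, h34]; exact hs)
      (by simp only [Function.comp, e3, h34]; exact N3) (c ∘ Equiv.swap 1 2)
      (by
        rw [h34]
        refine hc.trans ?_
        exact (Equiv.sum_comp (Equiv.swap (1 : Fin 4) 2) (fun i => c i • S i)).symm)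
    simp only [Function.comp, e1, e2, S1, S2] at r
    exact ⟨r.2.1, r.1, r.2.2⟩
  · rw [h0, zero_smul] at ht
    exact B.core (A 3) (Azo 3) (by rw [h34, S3])
      (fun i => Mcom _ (Fmem _) _ (Amem 3)) (fun i j => Mcom _ (Fmem _) _ (Smem _)) (Fsym _)
      (by rw [h34]; exact Nne) (by rw [h34]; exact N0)
      (by rw [h34]; exact ht) (by rw [h34]; exact N3) c (by rw [h34]; exact hc)
end

section
/- Let A_0, A_1, A_2, A_3, A_4 be a skew-symmetric association scheme on a finite nonempty set X with |X| = n, with primitive idempotents ordered as described. If its character table is of type 1 or of type 2, then each of the matrices A_1 + A_3 and A_2 + A_4 has exactly 5 distinct eigenvalues. -/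
open Matrix Polynomial

lemma aux_ext {X : Type*} [Fintype X] [DecidableEq X] {E : Fin 5 → Matrix X X ℂ}
    (hs : (∑ i, E i) = 1) {M N : Matrix X X ℂ} (h : ∀ i, M * E i = N * E i) : M = N := by
  rw [← mul_one M, ← mul_one N, ← hs, Finset.mul_sum, Finset.mul_sum]
  exact Finset.sum_congr rfl fun i _ => h i

lemma aux_eig {X : Type*} [Fintype X] [DecidableEq X] {E : Fin 5 → Matrix X X ℂ}
    (hs : (∑ i, E i) = 1) (ho : ∀ i j, E i * E j = if i = j then E i else 0)
    (hne : ∀ i, E i ≠ 0) (B : Matrix X X ℂ) (θ : Fin 5 → ℂ)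
    (hB : ∀ i, B * E i = θ i • E i) (hinj : Function.Injective θ) :
    numDistinctEigen B = 5 := by
  have key : B.charpoly.roots.toFinset = Finset.univ.image θ := by
    ext μ
    rw [Multiset.mem_toFinset, Polynomial.mem_roots (Matrix.charpoly_monic B).ne_zero,
      ← Matrix.mem_spectrum_iff_isRoot_charpoly, spectrum.mem_iff]
    simp only [Finset.mem_image, Finset.mem_univ, true_and]
    constructor
    · intro h
      by_contra hcon
      push Not at hcon
      apply h
      have h1 : (algebraMap ℂ (Matrix X X ℂ) μ - B) * (∑ i, (μ - θ i)⁻¹ • E i) = 1 := by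
        rw [Finset.mul_sum, ← hs]
        refine Finset.sum_congr rfl fun i _ => ?_
        rw [mul_smul_comm, sub_mul, hB, ← Algebra.smul_def, ← sub_smul, smul_smul,
          inv_mul_cancel₀ (sub_ne_zero.mpr (hcon i).symm), one_smul]
      exact IsUnit.of_mul_eq_one _ h1
    · rintro ⟨i, rfl⟩ hu
      have h0 : (algebraMap ℂ (Matrix X X ℂ) (θ i) - B) * E i = 0 := by
        rw [sub_mul, hB, ← Algebra.smul_def, sub_self]
      exact hne i ((hu.mul_right_eq_zero).1 h0)
  unfold numDistinctEigen
  rw [key, Finset.card_image_of_injective _ hinj]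
  simp

open scoped ComplexOrder in
lemma aux_adj {X : Type*} [Fintype X] [DecidableEq X] {M N E : Matrix X X ℂ} {p : ℂ}
    (hM : Mᴴ = N) (h1 : M * E = p • E) (h2 : ∃ q : ℂ, N * E = q • E) (hE : E ≠ 0) :
    N * E = (starRingEnd ℂ) p • E := by
  obtain ⟨q, h2⟩ := h2
  have h3 : Eᴴ * E ≠ 0 := by
    intro h
    exact hE (Matrix.conjTranspose_mul_self_eq_zero.1 h)
  have h4 : (Eᴴ * Mᴴ) * E = (starRingEnd ℂ p) • (Eᴴ * E) := by
    rw [← Matrix.conjTranspose_mul, h1, Matrix.conjTranspose_smul, smul_mul_assoc]; rfl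
  have h5 : (Eᴴ * Mᴴ) * E = q • (Eᴴ * E) := by
    rw [hM, mul_assoc, h2, mul_smul_comm]
  have h6 : q = starRingEnd ℂ p := smul_left_injective ℂ h3 (h5.symm.trans h4)
  rw [h2, h6]

lemma aux_disj {X : Type*} [Fintype X] [DecidableEq X] {A : Fin 5 → Matrix X X ℂ}
    (hA : IsAssocScheme A) {x y : X} {i j : Fin 5} (hij : i ≠ j) : A i x y * A j x y = 0 := by
  obtain ⟨-, h01, -, hJ, -⟩ := hA
  choose N hN using fun i x y => (show ∃ m : ℕ, A i x y = m by
    rcases h01 i x y with h | h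
    · exact ⟨0, by simp [h]⟩
    · exact ⟨1, by simp [h]⟩)
  have hs : ∑ i, N i x y = 1 := by
    have := congrFun (congrFun hJ x) y
    simp only [Matrix.sum_apply, hN, Matrix.of_apply] at this
    exact_mod_cast this
  rw [hN, hN]
  have : N i x y + N j x y ≤ 1 := by
    rw [← hs, ← Finset.sum_pair hij (f := fun i => N i x y)]
    exact Finset.sum_le_sum_of_subset (Finset.subset_univ _)
  have h : N i x y = 0 ∨ N j x y = 0 := by omega
  rcases h with h | h <;> simp [h]

lemma aux_ne {X : Type*} [Fintype X] [DecidableEq X] {A E : Fin 5 → Matrix X X ℂ}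
    (hA : IsAssocScheme A) (hE : ArePrimIdem A E) : ∀ i, E i ≠ 0 := by
  have hli : LinearIndependent ℂ A := by
    rw [Fintype.linearIndependent_iff]
    intro g hg i
    obtain ⟨x, y, hxy⟩ : ∃ x y, A i x y ≠ 0 := by
      by_contra h
      push Not at h
      exact hA.1 i (by ext x y; simp [h])
    have h := congrFun (congrFun hg x) y
    rw [Matrix.sum_apply, Finset.sum_eq_single i] at h
    · simpa [hxy] using h
    · intro j _ hj
      have := aux_disj hA (x := x) (y := y) hj
      simp only [mul_eq_zero, hxy, or_false] at this
      simp [this]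
    · simp
  have hsp : Submodule.span ℂ (Set.range A) ≤ Submodule.span ℂ (Set.range E) := by
    rw [Submodule.span_le]
    rintro _ ⟨i, rfl⟩
    have : A i = ∑ j, A i * E j := by rw [← Finset.mul_sum, hE.2.2.2.1, mul_one]
    rw [this]
    refine Submodule.sum_mem _ fun j _ => ?_
    obtain ⟨p, hp⟩ := hE.2.2.2.2 i j
    rw [hp]
    exact Submodule.smul_mem _ _ (Submodule.subset_span ⟨j, rfl⟩)
  have hE' : LinearIndependent ℂ E := by
    rw [linearIndependent_iff_card_le_finrank_span]
    rw [linearIndependent_iff_card_le_finrank_span] at hli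
    exact hli.trans (Submodule.finrank_mono hsp)
  exact fun i => hE'.ne_zero i

lemma aux_arith (n k r1 r2 α β : ℂ) (hn : n ≠ 0) (hk : k ≠ 0) (hk2 : n - 1 - k ≠ 0)
    (h1 : k + r1 * (n - 1 - k) + r2 * k = 0)
    (h2 : k ^ 2 + r1 ^ 2 * (n - 1 - k) + r2 ^ 2 * k = n * k)
    (h3 : n = k - r1 + (r2 - r1) * α) (h4 : 0 = k - r1 + (r2 - r1) * β) :
    n = (α - β) ^ 2 := by
  have h5 : n = k + r2 ^ 2 - r1 - r1 * r2 := by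
    apply mul_right_cancel₀ hk
    linear_combination r1 * h1 - h2
  have h6 : r2 + 1 ≠ 0 := by
    intro h
    have hr : r2 = -1 := by linear_combination h
    have hr1 : r1 = 0 := by
      subst hr
      have : r1 * (n - 1 - k) = 0 := by linear_combination h1
      simpa [hk2] using this
    subst hr hr1
    apply hk2
    linear_combination h5
  have h7 : k + r1 * (r2 - 1) - r1 ^ 2 = 0 := by
    have : (r2 + 1) * (k + r1 * (r2 - 1) - r1 ^ 2) = 0 := by
      linear_combination h1 - r1 * h5
    simpa [h6] using this
  have h8 : n = (r2 - r1) ^ 2 := by linear_combination h5 + h7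
  have h9 : n = (r2 - r1) * (α - β) := by linear_combination h3 - h4
  have h10 : r2 - r1 ≠ 0 := by
    intro h; rw [h] at h9; simp at h9; exact hn h9
  have h11 : r2 - r1 = α - β := by
    apply mul_left_cancel₀ h10
    linear_combination h9 - h8
  rw [← h11]; exact h8

def AuxEv {X : Type*} [Fintype X] (E : Fin 5 → Matrix X X ℂ)
    (M : Matrix X X ℂ) (m : Fin 5 → ℂ) : Prop := ∀ i, M * E i = m i • E i

lemma AuxEv.add {X : Type*} [Fintype X] {E : Fin 5 → Matrix X X ℂ} {M N : Matrix X X ℂ}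
    {m k : Fin 5 → ℂ} (h : AuxEv E M m) (h' : AuxEv E N k) : AuxEv E (M + N) (m + k) :=
  fun i => by rw [add_mul, h i, h' i, Pi.add_apply, add_smul]

lemma AuxEv.sub {X : Type*} [Fintype X] {E : Fin 5 → Matrix X X ℂ} {M N : Matrix X X ℂ}
    {m k : Fin 5 → ℂ} (h : AuxEv E M m) (h' : AuxEv E N k) : AuxEv E (M - N) (m - k) :=
  fun i => by rw [sub_mul, h i, h' i, Pi.sub_apply, sub_smul]

lemma AuxEv.mul {X : Type*} [Fintype X] {E : Fin 5 → Matrix X X ℂ} {M N : Matrix X X ℂ}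
    {m k : Fin 5 → ℂ} (h : AuxEv E M m) (h' : AuxEv E N k) : AuxEv E (M * N) (m * k) :=
  fun i => by rw [mul_assoc, h' i, mul_smul_comm, h i, Pi.mul_apply, smul_smul, mul_comm]

lemma AuxEv.smul {X : Type*} [Fintype X] {E : Fin 5 → Matrix X X ℂ} {M : Matrix X X ℂ}
    {m : Fin 5 → ℂ} (c : ℂ) (h : AuxEv E M m) : AuxEv E (c • M) (c • m) :=
  fun i => by rw [smul_mul_assoc, h i, smul_smul, Pi.smul_apply, smul_eq_mul]

lemma AuxEv.eq {X : Type*} [Fintype X] [DecidableEq X] {E : Fin 5 → Matrix X X ℂ}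
    (hs : (∑ i, E i) = 1) {M N : Matrix X X ℂ}
    {m k : Fin 5 → ℂ} (h : AuxEv E M m) (h' : AuxEv E N k) (e : ∀ i, m i = k i) : M = N :=
  aux_ext hs fun i => by rw [h i, h' i, e i]

lemma aux_core {X : Type*} [Fintype X] [DecidableEq X] [Nonempty X]
    (A E : Fin 5 → Matrix X X ℂ)
    (hA : IsAssocScheme A)
    (h12 : (A 1)ᵀ = A 2) (h34 : (A 3)ᵀ = A 4)
    (hE : ArePrimIdem A E)
    (r1 r2 t1 t2 b z : ℝ) (hb : 0 ≤ b) (hz : 0 ≤ z)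
    (a11 : A 1 * E 1 = ((r1 : ℂ) / 2) • E 1) (a12 : A 1 * E 2 = ((r1 : ℂ) / 2) • E 2)
    (a13 : A 1 * E 3 = (((r2 : ℂ) + Complex.I * b) / 2) • E 3)
    (a14 : A 1 * E 4 = (((r2 : ℂ) - Complex.I * b) / 2) • E 4)
    (a31 : A 3 * E 1 = (((t1 : ℂ) + Complex.I * z) / 2) • E 1)
    (a32 : A 3 * E 2 = (((t1 : ℂ) - Complex.I * z) / 2) • E 2)
    (a33 : A 3 * E 3 = ((t2 : ℂ) / 2) • E 3) (a34 : A 3 * E 4 = ((t2 : ℂ) / 2) • E 4) :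
    numDistinctEigen (A 1 + A 3) = 5 := by
  have hne := aux_ne hA hE
  have hd := fun (x y : X) (i j : Fin 5) (hij : i ≠ j) => aux_disj hA (x := x) (y := y) hij
  obtain ⟨hnz, h01, hA0, hJ, -, -, -⟩ := hA
  obtain ⟨-, hE0, ho, hs, hp⟩ := hE
  choose N hN using fun i x y => (show ∃ m : ℕ, A i x y = m by
    rcases h01 i x y with h | h
    · exact ⟨0, by simp [h]⟩
    · exact ⟨1, by simp [h]⟩)
  have hstar : ∀ i x y, star (A i x y) = A i x y := by
    intro i x y; rw [hN]; simp
  have c12 : (A 1)ᴴ = A 2 := by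
    rw [← h12]; ext x y; simp only [Matrix.conjTranspose_apply, Matrix.transpose_apply, hstar]
  have c34 : (A 3)ᴴ = A 4 := by
    rw [← h34]; ext x y; simp only [Matrix.conjTranspose_apply, Matrix.transpose_apply, hstar]
  have a21 := aux_adj c12 a11 (hp 2 1) (hne 1)
  have a22 := aux_adj c12 a12 (hp 2 2) (hne 2)
  have a23 := aux_adj c12 a13 (hp 2 3) (hne 3)
  have a24 := aux_adj c12 a14 (hp 2 4) (hne 4)
  have a41 := aux_adj c34 a31 (hp 4 1) (hne 1)
  have a42 := aux_adj c34 a32 (hp 4 2) (hne 2)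
  have a43 := aux_adj c34 a33 (hp 4 3) (hne 3)
  have a44 := aux_adj c34 a34 (hp 4 4) (hne 4)
  simp only [map_div₀, map_add, map_sub, map_mul, Complex.conj_ofReal, Complex.conj_I,
    map_ofNat] at a21 a22 a23 a24 a41 a42 a43 a44
  set n : ℂ := (Fintype.card X : ℂ) with hn
  have hn0 : n ≠ 0 := by simp [hn]
  -- row sums
  have rowsum : ∀ i (p : ℂ), A i * E 0 = p • E 0 → ∀ x, ∑ y, A i x y = p := by
    intro i p h x
    have h := congrFun (congrFun h x) x
    simp only [hE0, Matrix.mul_apply, Matrix.smul_apply, Matrix.of_apply, smul_eq_mul, mul_one,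
      ← Finset.sum_mul] at h
    exact mul_right_cancel₀ (inv_ne_zero hn0) h
  have rowpos : ∀ i, ∃ a : ℕ, a ≠ 0 ∧ A i * E 0 = (a : ℂ) • E 0 := by
    intro i
    obtain ⟨p, h⟩ := hp i 0
    obtain ⟨x, y, hxy⟩ : ∃ x y, A i x y ≠ 0 := by
      by_contra h
      push Not at h
      exact hnz i (by ext x y; simp [h])
    have h2 := rowsum i p h x
    refine ⟨∑ y, N i x y, ?_, ?_⟩
    · intro h0
      rw [Finset.sum_eq_zero_iff] at h0
      apply hxy
      rw [hN, h0 y (Finset.mem_univ _)]; simp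
    · rw [h, ← h2]; push_cast; simp only [hN]
  obtain ⟨a, ha, a10⟩ := rowpos 1
  obtain ⟨c, hc, a30⟩ := rowpos 3
  have a20 := aux_adj c12 a10 (hp 2 0) (hne 0)
  have a40 := aux_adj c34 a30 (hp 4 0) (hne 0)
  simp only [map_natCast] at a20 a40
  -- points
  have pt : ∀ i : Fin 5, ∃ x y, A i x y = 1 := by
    intro i
    by_contra h
    push Not at h
    exact hnz i (by ext x y; exact (h01 i x y).resolve_right (h x y))
  obtain ⟨u, v, huv⟩ := pt 1
  obtain ⟨f, g, hfg⟩ := pt 3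
  have hd1 : ∀ j, j ≠ 1 → A j u v = 0 := fun j hj => by
    have := hd u v j 1 hj
    rwa [huv, mul_one] at this
  have hd3 : ∀ j, j ≠ 3 → A j f g = 0 := fun j hj => by
    have := hd f g j 3 hj
    rwa [hfg, mul_one] at this
  have hJe : ∀ x y, A 0 x y + A 1 x y + A 2 x y + A 3 x y + A 4 x y = 1 := by
    intro x y
    have := congrFun (congrFun hJ x) y
    simpa [Fin.sum_univ_five] using this
  have hJ' : A 0 + A 1 + A 2 + A 3 + A 4 = n • E 0 := by
    ext x y
    rw [hE0]
    simp only [Matrix.add_apply, hJe, Matrix.smul_apply, Matrix.of_apply, smul_eq_mul, mul_one]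
    rw [mul_inv_cancel₀ hn0]
  have sc : ∀ (i : Fin 5) (p q : ℂ), p • E i = q • E i → p = q :=
    fun i p q h => smul_left_injective ℂ (hne i) h
  have s0 : 1 + (a : ℂ) + a + c + c = n := by
    apply sc 0
    have h := congrArg (· * E 0) hJ'
    simp only [add_mul, a10, a20, a30, a40, hA0, one_mul, smul_mul_assoc, ho, if_true] at h
    rw [← h]; module
  have s1 : r1 + t1 = -1 := by
    have : (r1 + t1 : ℂ) = -1 := by
      apply sc 1
      have h := congrArg (· * E 1) hJ'
      simp only [add_mul, a11, a21, a31, a41, hA0, one_mul, smul_mul_assoc, ho] at h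
      simp only [zero_ne_one, if_false, smul_zero] at h
      have h' := congrArg (· - E 1) h
      simp only [zero_sub] at h'
      rw [neg_one_smul, ← h']; module
    exact_mod_cast this
  have s3 : r2 + t2 = -1 := by
    have : (r2 + t2 : ℂ) = -1 := by
      apply sc 3
      have h := congrArg (· * E 3) hJ'
      simp only [add_mul, a13, a23, a33, a43, hA0, one_mul, smul_mul_assoc, ho] at h
      rw [if_neg (by decide), smul_zero] at h
      have h' := congrArg (· - E 3) h
      simp only [zero_sub] at h'
      rw [neg_one_smul, ← h']; module
    exact_mod_cast this
  have s1' : (t1 : ℂ) = -1 - r1 := by rw [eq_sub_iff_add_eq, add_comm]; exact_mod_cast s1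
  have s3' : (t2 : ℂ) = -1 - r2 := by rw [eq_sub_iff_add_eq, add_comm]; exact_mod_cast s3
  have II : Complex.I * Complex.I = -1 := Complex.I_mul_I
  have hEE : ∀ i j : Fin 5, i ≠ j → E i * E j = 0 := fun i j h => by rw [ho, if_neg h]
  have hEd : ∀ i : Fin 5, E i * E i = E i := fun i => by rw [ho, if_pos rfl]
  have e1 : AuxEv E (A 1) ![a, r1 / 2, r1 / 2, (r2 + Complex.I * b) / 2,
      (r2 - Complex.I * b) / 2] := by
    intro i; fin_cases i
    exacts [a10, a11, a12, a13, a14]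
  have e2 : AuxEv E (A 2) ![a, r1 / 2, r1 / 2, (r2 - Complex.I * b) / 2,
      (r2 + Complex.I * b) / 2] := by
    intro i; fin_cases i
    · exact a20
    · exact a21
    · exact a22
    · refine a23.trans ?_
      simp [sub_eq_add_neg]
    · refine a24.trans ?_
      simp
  have e3 : AuxEv E (A 3) ![c, (t1 + Complex.I * z) / 2, (t1 - Complex.I * z) / 2,
      t2 / 2, t2 / 2] := by
    intro i; fin_cases i
    exacts [a30, a31, a32, a33, a34]
  have e4 : AuxEv E (A 4) ![c, (t1 - Complex.I * z) / 2, (t1 + Complex.I * z) / 2,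
      t2 / 2, t2 / 2] := by
    intro i; fin_cases i
    · exact a40
    · refine a41.trans ?_
      simp [sub_eq_add_neg]
    · refine a42.trans ?_
      simp
    · exact a43
    · exact a44
  have eI : AuxEv E 1 ![1, 1, 1, 1, 1] := by
    intro i; fin_cases i <;> simp
  have eE : AuxEv E (E 0) ![1, 0, 0, 0, 0] := by
    intro i; fin_cases i <;> simp [ho]
  have eF : AuxEv E (E 3 + E 4) ![0, 0, 0, 1, 1] := by
    intro i; fin_cases i <;> simp [add_mul, ho]
  set F := E 3 + E 4 with hF
  have II : Complex.I ^ 2 = -1 := Complex.I_sq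
  have hCC : (A 1 - A 2) * (A 2 - A 1) = ((b : ℂ) ^ 2) • F := by
    refine ((e1.sub e2).mul (e2.sub e1)).eq hs (eF.smul _) ?_
    intro i; fin_cases i <;> simp
    all_goals linear_combination (-(b : ℂ) ^ 2) * II
  have hDD : (A 3 - A 4) * (A 4 - A 3) = ((z : ℂ) ^ 2) • (1 - E 0 - F) := by
    refine ((e3.sub e4).mul (e4.sub e3)).eq hs (((eI.sub eE).sub eF).smul _) ?_
    intro i; fin_cases i <;> simp
    all_goals linear_combination (-(z : ℂ) ^ 2) * II
  have hS : A 1 + A 2 = ((2 * a : ℂ)) • E 0 + (r1 : ℂ) • (1 - E 0 - F) + (r2 : ℂ) • F := by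
    refine (e1.add e2).eq hs (((eE.smul _).add (((eI.sub eE).sub eF).smul _)).add (eF.smul _)) ?_
    intro i; fin_cases i <;> simp <;> ring
  have hSS : (A 1 + A 2) * (A 1 + A 2) = ((2 * a : ℂ) ^ 2) • E 0 + ((r1 : ℂ) ^ 2) • (1 - E 0 - F)
      + ((r2 : ℂ) ^ 2) • F := by
    refine ((e1.add e2).mul (e1.add e2)).eq hs
      (((eE.smul _).add (((eI.sub eE).sub eF).smul _)).add (eF.smul _)) ?_
    intro i; fin_cases i <;> simp <;> ring
  have tr12 : ∀ x y, A 2 y x = A 1 x y := fun x y => by rw [← h12]; rfl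
  have tr34 : ∀ x y, A 4 y x = A 3 x y := fun x y => by rw [← h34]; rfl
  have sq : ∀ i x y, A i x y * A i x y = A i x y := fun i x y => by
    rcases h01 i x y with h | h <;> simp [h]
  obtain ⟨x0⟩ := ‹Nonempty X›
  have rs1 := rowsum 1 a a10 x0
  have rs2 := rowsum 2 a a20 x0
  have rs3 := rowsum 3 c a30 x0
  have rs4 := rowsum 4 c a40 x0
  have dCC : ((A 1 - A 2) * (A 2 - A 1)) x0 x0 = 2 * a := by
    rw [two_mul]; nth_rewrite 1 [← rs1]; rw [← rs2, ← Finset.sum_add_distrib, Matrix.mul_apply]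
    refine Finset.sum_congr rfl fun y _ => ?_
    rw [Matrix.sub_apply, Matrix.sub_apply, tr12 x0 y, ← tr12 y x0]
    linear_combination sq 1 x0 y + sq 2 x0 y - 2 * hd x0 y 1 2 (by decide)
  have dDD : ((A 3 - A 4) * (A 4 - A 3)) x0 x0 = 2 * c := by
    rw [two_mul]; nth_rewrite 1 [← rs3]; rw [← rs4, ← Finset.sum_add_distrib, Matrix.mul_apply]
    refine Finset.sum_congr rfl fun y _ => ?_
    rw [Matrix.sub_apply, Matrix.sub_apply, tr34 x0 y, ← tr34 y x0]
    linear_combination sq 3 x0 y + sq 4 x0 y - 2 * hd x0 y 3 4 (by decide)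
  have dSS : ((A 1 + A 2) * (A 1 + A 2)) x0 x0 = 2 * a := by
    rw [two_mul]; nth_rewrite 1 [← rs1]; rw [← rs2, ← Finset.sum_add_distrib, Matrix.mul_apply]
    refine Finset.sum_congr rfl fun y _ => ?_
    rw [Matrix.add_apply, Matrix.add_apply, tr12 x0 y, ← tr12 y x0]
    linear_combination sq 1 x0 y + sq 2 x0 y + 2 * hd x0 y 1 2 (by decide)
  have dS : (A 1 + A 2) x0 x0 = 0 := by
    have h1 := hd x0 x0 0 1 (by decide)
    have h2 := hd x0 x0 0 2 (by decide)
    rw [hA0, Matrix.one_apply_eq, one_mul] at h1 h2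
    rw [Matrix.add_apply, h1, h2, add_zero]
  have E0e : ∀ x y, E 0 x y = n⁻¹ := fun x y => by rw [hE0]; simp
  have haC : (a : ℂ) ≠ 0 := by exact_mod_cast ha
  have hcC : (c : ℂ) ≠ 0 := by exact_mod_cast hc
  have hb0 : b ≠ 0 := by
    rintro rfl
    rw [hCC] at dCC
    simp at dCC
    exact ha dCC
  have hz0 : z ≠ 0 := by
    rintro rfl
    rw [hDD] at dDD
    simp at dDD
    exact hc dDD
  have hbz : b ≠ z := by
    intro hbz
    subst hbz
    rw [hCC] at dCC
    rw [hDD] at dDD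
    rw [hS] at dS
    rw [hSS] at dSS
    simp only [Matrix.smul_apply, Matrix.sub_apply, Matrix.add_apply, Matrix.one_apply_eq, E0e,
      smul_eq_mul] at dCC dDD dS dSS
    have hac : n - 1 ≠ 0 := by
      have : (2 * a + 2 * c : ℂ) ≠ 0 := by
        have : 2 * a + 2 * c ≠ 0 := by omega
        exact_mod_cast this
      intro h; apply this; linear_combination s0 + h
    have nn : n * n⁻¹ = 1 := mul_inv_cancel₀ hn0
    have hb2 : (b : ℂ) ^ 2 = n := by
      apply mul_right_cancel₀ hac
      linear_combination n * (dCC + dDD) + (b : ℂ) ^ 2 * nn + n * s0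
    rw [hb2] at dCC hCC
    have huv0 : (1 : Matrix X X ℂ) u v = 0 := by rw [← hA0]; exact hd1 0 (by decide)
    have hfg0 : (1 : Matrix X X ℂ) f g = 0 := by rw [← hA0]; exact hd3 0 (by decide)
    have intCC : ∀ x y, ∃ α : ℤ, n * F x y = α := by
      intro x y
      refine ⟨∑ w, ((N 1 x w : ℤ) - N 2 x w) * ((N 2 w y : ℤ) - N 1 w y), ?_⟩
      have := congrFun (congrFun hCC x) y
      simp only [Matrix.smul_apply, smul_eq_mul] at this
      rw [← this, Matrix.mul_apply]
      push_cast
      simp only [Matrix.sub_apply, hN]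
    obtain ⟨α, hα⟩ := intCC u v
    obtain ⟨β, hβ⟩ := intCC f g
    have S1 := congrFun (congrFun hS u) v
    have S3 := congrFun (congrFun hS f) g
    simp only [Matrix.smul_apply, Matrix.sub_apply, Matrix.add_apply, E0e, huv0, hfg0,
      smul_eq_mul, huv, hd1 2 (by decide), hd3 1 (by decide), hd3 2 (by decide)] at S1 S3
    have main : n = ((α : ℂ) - β) ^ 2 := by
      refine aux_arith n (2 * a) r1 r2 α β hn0 (by simpa using ha) ?_ ?_ ?_ ?_ ?_
      · intro h
        apply hcC
        linear_combination (h + s0) / 2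
      · linear_combination n * dS + (r1 - r2) * dCC + (r1 - 2 * a) * nn
      · linear_combination n * dSS + (r1 ^ 2 - r2 ^ 2) * dCC + (r1 ^ 2 - (2 * a) ^ 2) * nn
      · linear_combination n * S1 + (r2 - r1) * hα + (2 * a - r1) * nn
      · linear_combination n * S3 + (r2 - r1) * hβ + (2 * a - r1) * nn
    have hBB : (A 1 + A 3) * (A 2 + A 4) = ((a + c : ℂ) ^ 2) • E 0 +
        ((1 + n) / 4) • (1 - E 0) := by
      refine ((e1.add e3).mul (e2.add e4)).eq hs ((eE.smul _).add ((eI.sub eE).smul _)) ?_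
      intro i; fin_cases i <;> simp
      · ring
      all_goals simp only [s1', s3']; linear_combination hb2 / 4 - (b : ℂ) ^ 2 / 4 * II
    have B1 := congrFun (congrFun hBB u) v
    simp only [Matrix.smul_apply, Matrix.sub_apply, Matrix.add_apply, E0e, huv0,
      smul_eq_mul] at B1
    have intB : ∃ γ : ℤ, ((A 1 + A 3) * (A 2 + A 4)) u v = γ := by
      refine ⟨∑ w, ((N 1 u w : ℤ) + N 3 u w) * ((N 2 w v : ℤ) + N 4 w v), ?_⟩
      rw [Matrix.mul_apply]
      push_cast
      simp only [Matrix.add_apply, hN]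
    obtain ⟨γ, hγ⟩ := intB
    rw [hγ] at B1
    have hac2 : (a + c : ℂ) = (n - 1) / 2 := by linear_combination s0 / 2
    rw [hac2] at B1
    have h4 : 4 * (γ : ℂ) = n - 3 := by
      linear_combination 4 * B1 + (n - 3) * nn
    have h4' : 4 * γ = (Fintype.card X : ℤ) - 3 := by
      rw [hn] at h4; exact_mod_cast h4
    have main' : (Fintype.card X : ℤ) = (α - β) ^ 2 := by
      rw [hn] at main; exact_mod_cast main
    rcases Int.even_or_odd' (α - β) with ⟨q, hq | hq⟩
    · rw [hq] at main'; ring_nf at main'; omega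
    · rw [hq] at main'; ring_nf at main'; omega
  refine aux_eig hs ho hne _ ![a + c, (-1 + Complex.I * z) / 2, (-1 - Complex.I * z) / 2,
    (-1 + Complex.I * b) / 2, (-1 - Complex.I * b) / 2] ?_ ?_
  · intro i
    rw [(e1.add e3) i]
    congr 1
    fin_cases i <;> simp <;> simp only [s1', s3'] <;> ring
  · have hb' : 0 < b := lt_of_le_of_ne hb (Ne.symm hb0)
    have hz' : 0 < z := lt_of_le_of_ne hz (Ne.symm hz0)
    have hac : (0 : ℝ) ≤ a + c := by positivity
    intro i j hij
    have hre := congrArg Complex.re hij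
    have him := congrArg Complex.im hij
    by_contra hne'
    fin_cases i <;> fin_cases j <;> simp at hre him hne'
    all_goals first
      | linarith
      | exact hbz (by linarith)

theorem stmt13 {X : Type*} [Fintype X] [DecidableEq X] [Nonempty X]
    (A E : Fin 5 → Matrix X X ℂ)
    (hA : IsAssocScheme A)
    (h12 : (A 1)ᵀ = A 2) (h34 : (A 3)ᵀ = A 4)
    (hE : ArePrimIdem A E)
    (k1 k2 m1 m2 : ℝ)
    (hk1 : ∀ x : X, ∑ y : X, (A 1 + A 2) x y = (k1 : ℂ))
    (hk2 : ∀ x : X, ∑ y : X, (A 3 + A 4) x y = (k2 : ℂ))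
    (hm1 : (E 1).trace = ((m1 / 2 : ℝ) : ℂ) ∧ (E 2).trace = ((m1 / 2 : ℝ) : ℂ))
    (hm2 : (E 3).trace = ((m2 / 2 : ℝ) : ℂ) ∧ (E 4).trace = ((m2 / 2 : ℝ) : ℂ))
    (ρ σ τ ω : ℂ)
    (hρ1 : A 1 * E 1 = ρ • E 1) (hρ2 : A 1 * E 2 = (starRingEnd ℂ) ρ • E 2)
    (hσ1 : A 1 * E 3 = σ • E 3) (hσ2 : A 1 * E 4 = (starRingEnd ℂ) σ • E 4)
    (hτ1 : A 3 * E 1 = τ • E 1) (hτ2 : A 3 * E 2 = (starRingEnd ℂ) τ • E 2)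
    (hω1 : A 3 * E 3 = ω • E 3) (hω2 : A 3 * E 4 = (starRingEnd ℂ) ω • E 4)
    (htype :
      (∃ r1 r2 t1 t2 : ℝ,
        ρ = (r1 : ℂ) / 2 ∧
        σ = ((r2 : ℂ) + Complex.I * ((Real.sqrt ((Fintype.card X : ℝ) * k1 / m2) : ℝ) : ℂ)) / 2 ∧
        τ = ((t1 : ℂ) + Complex.I * ((Real.sqrt ((Fintype.card X : ℝ) * k2 / m1) : ℝ) : ℂ)) / 2 ∧
        ω = (t2 : ℂ) / 2) ∨
      (∃ r1 r2 t1 t2 : ℝ,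
        ρ = ((r1 : ℂ) + Complex.I * ((Real.sqrt ((Fintype.card X : ℝ) * k1 / m1) : ℝ) : ℂ)) / 2 ∧
        σ = (r2 : ℂ) / 2 ∧
        τ = (t1 : ℂ) / 2 ∧
        ω = ((t2 : ℂ) + Complex.I * ((Real.sqrt ((Fintype.card X : ℝ) * k2 / m2) : ℝ) : ℂ)) / 2)) :
    numDistinctEigen (A 1 + A 3) = 5 ∧ numDistinctEigen (A 2 + A 4) = 5 := by
  have fin : numDistinctEigen (A 1 + A 3) = 5 := by
    rcases htype with ⟨r1, r2, t1, t2, rfl, rfl, rfl, rfl⟩ | ⟨r1, r2, t1, t2, rfl, rfl, rfl, rfl⟩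
    · simp only [map_div₀, map_add, map_mul, Complex.conj_ofReal, Complex.conj_I, map_ofNat,
        neg_mul, ← sub_eq_add_neg] at hρ2 hσ2 hτ2 hω2
      exact aux_core A E hA h12 h34 hE r1 r2 t1 t2 _ _ (Real.sqrt_nonneg _) (Real.sqrt_nonneg _)
        hρ1 hρ2 hσ1 hσ2 hτ1 hτ2 hω1 hω2
    · simp only [map_div₀, map_add, map_mul, Complex.conj_ofReal, Complex.conj_I, map_ofNat,
        neg_mul, ← sub_eq_add_neg] at hρ2 hσ2 hτ2 hω2
      have hE' : ArePrimIdem A ![E 0, E 3, E 4, E 1, E 2] := by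
        obtain ⟨q1, q2, q3, q4, q5⟩ := hE
        refine ⟨?_, q2, ?_, ?_, ?_⟩
        · intro i; fin_cases i <;> exact q1 _
        · intro i j; fin_cases i <;> fin_cases j <;> simp [q3]
        · rw [← q4]; simp [Fin.sum_univ_five]; abel
        · intro i j; fin_cases j <;> exact q5 _ _
      exact aux_core A ![E 0, E 3, E 4, E 1, E 2] hA h12 h34 hE' r2 r1 t2 t1 _ _
        (Real.sqrt_nonneg _) (Real.sqrt_nonneg _)
        hσ1 hσ2 hρ1 hρ2 hω1 hω2 hτ1 hτ2
  refine ⟨fin, ?_⟩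
  have : A 2 + A 4 = (A 1 + A 3)ᵀ := by rw [Matrix.transpose_add, h12, h34]
  refine Eq.trans ?_ fin
  rw [this]
  unfold numDistinctEigen
  rw [Matrix.charpoly_transpose]
end
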